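/- Let γ : ℝ × (-∞,0] → ℝ² be an ancient complete non-compact embedded smooth curve shortening flow whose entropy Ent equals a positive integer m. Then for every t ≤ 0, the total curvature satisfies TC(t) = ∫_ℝ |κ(u,t)| |∂_u γ(u,t)| du ≤ (2m - 1)π. -/

import Mathlib

open Real MeasureTheory Set Filter
open scoped RealInnerProductSpace ENNReal

noncomputable section

/-- The Euclidean plane. -/
abbrev R2 := EuclideanSpace ℝ (Fin 2)

/-- The point of `ℝ²` with coordinates `(x, y)`. -/
def toR2 (x y : ℝ) : R2 := (WithLp.equiv 2 (Fin 2 → ℝ)).symm ![x, y]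

/-- Counterclockwise rotation of the plane by `π/2`. -/
def Jrot (v : R2) : R2 := toR2 (-(v 1)) (v 0)

/-- Arclength derivative `∂ₛ := |∂ᵤγ|⁻¹ ∂ᵤ` along the time-`t` curve of the flow `γ`,
applied to a function `f` of `(u, t)`. -/
def aderiv (γ : ℝ → ℝ → R2) {F : Type} [NormedAddCommGroup F] [NormedSpace ℝ F]
    (f : ℝ → ℝ → F) (u t : ℝ) : F :=
  ‖deriv (fun v => γ v t) u‖⁻¹ • deriv (fun v => f v t) u

/-- The unit tangent `T = ∂ᵤγ / |∂ᵤγ|`. -/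
def unitT (γ : ℝ → ℝ → R2) (u t : ℝ) : R2 := aderiv γ γ u t

/-- The unit normal `n = J T`. -/
def unitN (γ : ℝ → ℝ → R2) (u t : ℝ) : R2 := Jrot (unitT γ u t)

/-- The signed curvature `κ = ⟨∂ₛT, n⟩`. -/
def curv (γ : ℝ → ℝ → R2) (u t : ℝ) : ℝ := ⟪aderiv γ (unitT γ) u t, unitN γ u t⟫

/-- `γ : ℝ × I → ℝ²` is a smooth curve shortening flow in fixed-parametrization form:
smooth, regular (`∂ᵤγ ≠ 0`), and `∂ₜγ = ∂ₛ(∂ₛγ)` (time derivative taken within `I`). -/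
structure IsCSF (γ : ℝ → ℝ → R2) (I : Set ℝ) : Prop where
  smooth : ContDiffOn ℝ (⊤ : ℕ∞) (fun p : ℝ × ℝ => γ p.1 p.2) (univ ×ˢ I)
  regular : ∀ (u : ℝ), ∀ t ∈ I, deriv (fun v => γ v t) u ≠ 0
  flow : ∀ (u : ℝ), ∀ t ∈ I, derivWithin (fun s => γ u s) I t = aderiv γ (aderiv γ γ) u t

/-- The Gaussian weighted length `F_{x₀,l}` of the time-`t` curve (as an extended real). -/
def gaussLenE (γ : ℝ → ℝ → R2) (x₀ : R2) (l t : ℝ) : ℝ≥0∞ :=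
  (ENNReal.ofReal (Real.sqrt (4 * π * l)))⁻¹ *
    ∫⁻ u : ℝ, ENNReal.ofReal
      (Real.exp (-‖γ u t - x₀‖ ^ 2 / (4 * l)) * ‖deriv (fun v => γ v t) u‖)

/-- The total curvature of the time-`t` curve (as an extended real). -/
def totalCurvE (γ : ℝ → ℝ → R2) (t : ℝ) : ℝ≥0∞ :=
  ∫⁻ u : ℝ, ENNReal.ofReal (|curv γ u t| * ‖deriv (fun v => γ v t) u‖)

/-- The entropy of the flow: the supremum of the Gaussian weighted lengths over all
times `t ∈ I`, centers `x₀ ∈ ℝ²` and scales `l > 0`. -/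
def entropyE (γ : ℝ → ℝ → R2) (I : Set ℝ) : ℝ≥0∞ :=
  ⨆ t ∈ I, ⨆ x₀ : R2, ⨆ l ∈ Ioi (0:ℝ), gaussLenE γ x₀ l t

/-- Scalar form of a curve shortening flow on negative times, with Gaussian length bound. -/
structure CFlow (M : ℝ) (X Y g c s k : ℝ → ℝ → ℝ) : Prop where
  dX : ∀ u t, t < 0 → DifferentiableAt ℝ (fun p : ℝ × ℝ => X p.1 p.2) (u, t)
  dY : ∀ u t, t < 0 → DifferentiableAt ℝ (fun p : ℝ × ℝ => Y p.1 p.2) (u, t)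
  dg : ∀ u t, t < 0 → DifferentiableAt ℝ (fun p : ℝ × ℝ => g p.1 p.2) (u, t)
  dc : ∀ u t, t < 0 → DifferentiableAt ℝ (fun p : ℝ × ℝ => c p.1 p.2) (u, t)
  ds : ∀ u t, t < 0 → DifferentiableAt ℝ (fun p : ℝ × ℝ => s p.1 p.2) (u, t)
  ck : ∀ u t, t < 0 → ContinuousAt (fun p : ℝ × ℝ => k p.1 p.2) (u, t)
  Xu : ∀ u t, t < 0 → HasDerivAt (fun v => X v t) (g u t * c u t) u
  Yu : ∀ u t, t < 0 → HasDerivAt (fun v => Y v t) (g u t * s u t) u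
  cu : ∀ u t, t < 0 → HasDerivAt (fun v => c v t) (-(g u t * k u t * s u t)) u
  su : ∀ u t, t < 0 → HasDerivAt (fun v => s v t) (g u t * k u t * c u t) u
  Xt : ∀ u t, t < 0 → HasDerivAt (fun r => X u r) (-(k u t * s u t)) t
  Yt : ∀ u t, t < 0 → HasDerivAt (fun r => Y u r) (k u t * c u t) t
  gt : ∀ u t, t < 0 → HasDerivAt (fun r => g u r) (-(g u t * k u t ^ 2)) t
  gpos : ∀ u t, t < 0 → 0 < g u t
  cs : ∀ u t, t < 0 → c u t ^ 2 + s u t ^ 2 = 1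
  proper : ∀ t, t < 0 → ∀ R : ℝ, ∃ U : ℝ, ∀ u, U ≤ |u| → R ≤ X u t ^ 2 + Y u t ^ 2
  ent : ∀ t, t < 0 → ∀ l, 0 < l → ∀ a b, a ≤ b →
    ∫ u in a..b, Real.exp (-(X u t ^ 2 + Y u t ^ 2) / (4 * l)) * g u t ≤ M * Real.sqrt l

/-- The unnormalised Gaussian weight at time `t` (backwards from the origin). -/
def rhoF (X Y : ℝ → ℝ → ℝ) (u t : ℝ) : ℝ :=
  Real.exp (-(X u t ^ 2 + Y u t ^ 2) / (4 * (-t))) / Real.sqrt (-t)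

/-- Tangential component of the position. -/
def zF (X Y c s : ℝ → ℝ → ℝ) (u t : ℝ) : ℝ := X u t * c u t + Y u t * s u t

/-- Normal component of the position. -/
def wF (X Y c s : ℝ → ℝ → ℝ) (u t : ℝ) : ℝ := -(X u t * s u t) + Y u t * c u t

/-- Shrinker defect. -/
def vF (X Y c s k : ℝ → ℝ → ℝ) (u t : ℝ) : ℝ := k u t + wF X Y c s u t / (2 * (-t))

lemma fderiv_fst_of {F : ℝ × ℝ → ℝ} {u t d : ℝ} (hF : DifferentiableAt ℝ F (u, t))
    (h : HasDerivAt (fun v => F (v, t)) d u) : fderiv ℝ F (u, t) (1, 0) = d := by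
  have h1 : HasDerivAt (fun v : ℝ => ((v, t) : ℝ × ℝ)) ((1 : ℝ), (0 : ℝ)) u :=
    (hasDerivAt_id u).prodMk (hasDerivAt_const u t)
  have h2 := hF.hasFDerivAt.comp_hasDerivAt u h1
  exact h2.unique h

lemma fderiv_snd_of {F : ℝ × ℝ → ℝ} {u t d : ℝ} (hF : DifferentiableAt ℝ F (u, t))
    (h : HasDerivAt (fun r => F (u, r)) d t) : fderiv ℝ F (u, t) (0, 1) = d := by
  have h1 : HasDerivAt (fun v : ℝ => ((u, v) : ℝ × ℝ)) ((0 : ℝ), (1 : ℝ)) t :=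
    (hasDerivAt_const t u).prodMk (hasDerivAt_id t)
  have h2 := hF.hasFDerivAt.comp_hasDerivAt t h1
  exact h2.unique h

lemma diffAt_div {F G : ℝ × ℝ → ℝ} {x : ℝ × ℝ} (hF : DifferentiableAt ℝ F x)
    (hG : DifferentiableAt ℝ G x) (h0 : G x ≠ 0) :
    DifferentiableAt ℝ (fun p => F p / G p) x := by
  simp only [div_eq_mul_inv]
  exact hF.mul (hG.inv h0)

namespace CFlow

variable {M : ℝ} {X Y g c s k : ℝ → ℝ → ℝ}

lemma drho (h : CFlow M X Y g c s k) (u t : ℝ) (ht : t < 0) :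
    DifferentiableAt ℝ (fun p : ℝ × ℝ => rhoF X Y p.1 p.2) (u, t) := by
  unfold rhoF
  have h1 := h.dX u t ht
  have h2 := h.dY u t ht
  have h3 : DifferentiableAt ℝ (fun p : ℝ × ℝ => p.2) (u, t) := differentiableAt_snd
  refine diffAt_div ?_ ?_ ?_
  · refine DifferentiableAt.exp ?_
    refine diffAt_div ?_ ?_ ?_
    · exact ((h1.pow 2).add (h2.pow 2)).neg
    · exact (h3.neg).const_mul 4
    · simp; linarith
  · exact DifferentiableAt.sqrt h3.neg (by simp; linarith)
  · have : 0 < -t := by linarith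
    simpa using (Real.sqrt_pos.2 this).ne'

lemma rho_u (h : CFlow M X Y g c s k) (u t : ℝ) (ht : t < 0) :
    HasDerivAt (fun v => rhoF X Y v t)
      (-(rhoF X Y u t * g u t * zF X Y c s u t / (2 * (-t)))) u := by
  have h1 := h.Xu u t ht
  have h2 := h.Yu u t ht
  have h3 := ((((h1.pow 2).add (h2.pow 2)).neg.div_const (4 * (-t))).exp).div_const (Real.sqrt (-t))
  refine h3.congr_deriv ?_
  have : 0 < -t := by linarith
  have h4 := (Real.sqrt_pos.2 this).ne'
  simp only [rhoF, zF]
  have : t ≠ 0 := ht.ne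
  simp
  field_simp
  ring

lemma rho_t (h : CFlow M X Y g c s k) (u t : ℝ) (ht : t < 0) :
    HasDerivAt (fun r => rhoF X Y u r)
      (rhoF X Y u t * (1 / (2 * (-t)) - (X u t ^ 2 + Y u t ^ 2) / (4 * t ^ 2)
        - k u t * wF X Y c s u t / (2 * (-t)))) t := by
  have h1 := h.Xt u t ht
  have h2 := h.Yt u t ht
  have hpos : 0 < -t := by linarith
  have h4 := (Real.sqrt_pos.2 hpos).ne'
  have hne : t ≠ 0 := ht.ne
  have h5 : HasDerivAt (fun r : ℝ => 4 * (-r)) (4 * (-1)) t := (hasDerivAt_neg t).const_mul 4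
  have h6 : HasDerivAt (fun r : ℝ => Real.sqrt (-r)) (-1 / (2 * Real.sqrt (-t))) t :=
    (hasDerivAt_neg t).sqrt hpos.ne'
  have h3 := ((((h1.pow 2).add (h2.pow 2)).neg.div h5 (by simpa using hne)).exp).div h6 h4
  refine h3.congr_deriv ?_
  simp only [rhoF, wF]
  have hsq : Real.sqrt (-t) ^ 2 = -t := Real.sq_sqrt hpos.le
  simp only [Pi.neg_apply, Pi.add_apply, Pi.pow_apply, Pi.div_apply]
  set S := Real.sqrt (-t)
  have ht2 : t = - S ^ 2 := by linarith
  rw [ht2]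
  field_simp
  ring

lemma zu (h : CFlow M X Y g c s k) (u t : ℝ) (ht : t < 0) :
    HasDerivAt (fun v => zF X Y c s v t) (g u t * (1 + k u t * wF X Y c s u t)) u := by
  have h3 := ((h.Xu u t ht).mul (h.cu u t ht)).add ((h.Yu u t ht).mul (h.su u t ht))
  refine h3.congr_deriv ?_
  simp only [wF]
  have := h.cs u t ht
  linear_combination (g u t) * this

lemma wu (h : CFlow M X Y g c s k) (u t : ℝ) (ht : t < 0) :
    HasDerivAt (fun v => wF X Y c s v t) (-(g u t * k u t * zF X Y c s u t)) u := by
  have h3 := ((h.Xu u t ht).mul (h.su u t ht)).neg.add ((h.Yu u t ht).mul (h.cu u t ht))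
  refine h3.congr_deriv ?_
  simp only [zF]
  ring

lemma dz (h : CFlow M X Y g c s k) (u t : ℝ) (ht : t < 0) :
    DifferentiableAt ℝ (fun p : ℝ × ℝ => zF X Y c s p.1 p.2) (u, t) :=
  ((h.dX u t ht).mul (h.dc u t ht)).add ((h.dY u t ht).mul (h.ds u t ht))

lemma dw (h : CFlow M X Y g c s k) (u t : ℝ) (ht : t < 0) :
    DifferentiableAt ℝ (fun p : ℝ × ℝ => wF X Y c s p.1 p.2) (u, t) :=
  ((h.dX u t ht).mul (h.ds u t ht)).neg.add ((h.dY u t ht).mul (h.dc u t ht))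

lemma cv (h : CFlow M X Y g c s k) (u t : ℝ) (ht : t < 0) :
    ContinuousAt (fun p : ℝ × ℝ => vF X Y c s k p.1 p.2) (u, t) := by
  refine (h.ck u t ht).add ((h.dw u t ht).continuousAt.div ?_ ?_)
  · fun_prop
  · simpa using ht.ne

lemma rho_pos {X Y : ℝ → ℝ → ℝ} (u t : ℝ) (ht : t < 0) : 0 < rhoF X Y u t :=
  div_pos (Real.exp_pos _) (Real.sqrt_pos.2 (by linarith))

/-- position decomposes into tangential and normal components -/
lemma zw (h : CFlow M X Y g c s k) (u t : ℝ) (ht : t < 0) :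
    zF X Y c s u t ^ 2 + wF X Y c s u t ^ 2 = X u t ^ 2 + Y u t ^ 2 := by
  simp only [zF, wF]
  linear_combination (X u t ^ 2 + Y u t ^ 2) * h.cs u t ht

/-- The boundary flux. -/
def BF (X Y c s : ℝ → ℝ → ℝ) (u t : ℝ) : ℝ := zF X Y c s u t * rhoF X Y u t / (2 * (-t))

lemma dB (h : CFlow M X Y g c s k) (u t : ℝ) (ht : t < 0) :
    DifferentiableAt ℝ (fun p : ℝ × ℝ => BF X Y c s p.1 p.2) (u, t) := by
  unfold BF
  refine diffAt_div ((h.dz u t ht).mul (h.drho u t ht)) ?_ ?_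
  · fun_prop
  · simpa using ht.ne

lemma monotonicity (h : CFlow M X Y g c s k) (a b t₁ t₂ : ℝ) (ht : t₁ ≤ t₂) (ht2 : t₂ < 0) :
    (∫ u in a..b, rhoF X Y u t₂ * g u t₂) +
      (∫ u in a..b, ∫ t in t₁..t₂, rhoF X Y u t * g u t * vF X Y c s k u t ^ 2) =
    (∫ u in a..b, rhoF X Y u t₁ * g u t₁) +
      ((∫ t in t₁..t₂, BF X Y c s b t) - ∫ t in t₁..t₂, BF X Y c s a t) := by
  have hneg : ∀ x ∈ (uIcc a b ×ˢ uIcc t₁ t₂ : Set (ℝ × ℝ)), x.2 < 0 := by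
    rintro ⟨u, t⟩ ⟨-, hx⟩
    rw [uIcc_of_le ht] at hx
    exact lt_of_le_of_lt hx.2 ht2
  have hneg' : ∀ x ∈ (Ioo (min a b) (max a b) ×ˢ Ioo (min t₁ t₂) (max t₁ t₂) : Set (ℝ × ℝ)), x.2 < 0 := by
    rintro ⟨u, t⟩ ⟨-, hx⟩
    rw [max_eq_right ht] at hx
    exact lt_trans hx.2 ht2
  have hdf : ∀ x : ℝ × ℝ, x.2 < 0 → DifferentiableAt ℝ (fun p : ℝ × ℝ => -BF X Y c s p.1 p.2) x :=
    fun x hx => (h.dB x.1 x.2 hx).neg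
  have hdg : ∀ x : ℝ × ℝ, x.2 < 0 → DifferentiableAt ℝ (fun p : ℝ × ℝ => rhoF X Y p.1 p.2 * g p.1 p.2) x :=
    fun x hx => (h.drho x.1 x.2 hx).mul (h.dg x.1 x.2 hx)
  have key : ∀ x : ℝ × ℝ, x.2 < 0 →
      fderiv ℝ (fun p : ℝ × ℝ => -BF X Y c s p.1 p.2) x (1, 0) +
      fderiv ℝ (fun p : ℝ × ℝ => rhoF X Y p.1 p.2 * g p.1 p.2) x (0, 1) =
      -(rhoF X Y x.1 x.2 * g x.1 x.2 * vF X Y c s k x.1 x.2 ^ 2) := by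
    rintro ⟨u, t⟩ hx
    simp only at hx
    have e1 := fderiv_fst_of (hdf (u, t) hx)
      ((((h.zu u t hx).mul (h.rho_u u t hx)).div_const (2 * (-t))).neg)
    have e2 := fderiv_snd_of (hdg (u, t) hx) ((h.rho_t u t hx).mul (h.gt u t hx))
    rw [e1, e2]
    have hzw := h.zw u t hx
    simp only [vF]
    have hne : t ≠ 0 := hx.ne
    field_simp
    linear_combination (4 * rhoF X Y u t * g u t ) * hzw
  have hintg : IntegrableOn (fun x : ℝ × ℝ => fderiv ℝ (fun p : ℝ × ℝ => -BF X Y c s p.1 p.2) x (1, 0) +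
      fderiv ℝ (fun p : ℝ × ℝ => rhoF X Y p.1 p.2 * g p.1 p.2) x (0, 1)) (uIcc a b ×ˢ uIcc t₁ t₂) := by
    have hc : IsCompact (uIcc a b ×ˢ uIcc t₁ t₂ : Set (ℝ × ℝ)) := isCompact_uIcc.prod isCompact_uIcc
    refine IntegrableOn.congr_fun (f := fun x : ℝ × ℝ =>
      -(rhoF X Y x.1 x.2 * g x.1 x.2 * vF X Y c s k x.1 x.2 ^ 2)) ?_
      (fun x hx => (key x (hneg x hx)).symm) hc.measurableSet
    refine ContinuousOn.integrableOn_compact hc ?_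
    intro x hx
    have hx2 := hneg x hx
    exact (((hdg x hx2).continuousAt.mul ((h.cv x.1 x.2 hx2).pow 2)).neg).continuousWithinAt
  have D := integral2_divergence_prod_of_hasFDerivAt
    (fun p : ℝ × ℝ => -BF X Y c s p.1 p.2) (fun p : ℝ × ℝ => rhoF X Y p.1 p.2 * g p.1 p.2)
    (fderiv ℝ (fun p : ℝ × ℝ => -BF X Y c s p.1 p.2))
    (fderiv ℝ (fun p : ℝ × ℝ => rhoF X Y p.1 p.2 * g p.1 p.2)) a t₁ b t₂
    (fun x hx => (hdf x (hneg x hx)).continuousAt.continuousWithinAt)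
    (fun x hx => (hdg x (hneg x hx)).continuousAt.continuousWithinAt)
    (fun x hx => (hdf x (hneg' x hx)).hasFDerivAt)
    (fun x hx => (hdg x (hneg' x hx)).hasFDerivAt) hintg
  have D2 : (∫ x in a..b, ∫ y in t₁..t₂, fderiv ℝ (fun p : ℝ × ℝ => -BF X Y c s p.1 p.2) (x, y) (1, 0) +
      fderiv ℝ (fun p : ℝ × ℝ => rhoF X Y p.1 p.2 * g p.1 p.2) (x, y) (0, 1)) =
      -(∫ u in a..b, ∫ t in t₁..t₂, rhoF X Y u t * g u t * vF X Y c s k u t ^ 2) := by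
    rw [← intervalIntegral.integral_neg]
    refine intervalIntegral.integral_congr (fun u hu => ?_)
    rw [← intervalIntegral.integral_neg]
    refine intervalIntegral.integral_congr (fun t htt => ?_)
    exact key (u, t) (hneg (u, t) ⟨hu, htt⟩)
  rw [D2] at D
  simp only [intervalIntegral.integral_neg] at D
  linarith

end CFlow

/-- The truncated Gaussian integral. -/
def PhiF (l y : ℝ) : ℝ := ∫ z in (0 : ℝ)..y, Real.exp (-z ^ 2 / (4 * l))

lemma PhiF_cont (l : ℝ) : Continuous (fun z : ℝ => Real.exp (-z ^ 2 / (4 * l))) := by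
  fun_prop

lemma PhiF_hasDerivAt (l y : ℝ) : HasDerivAt (PhiF l) (Real.exp (-y ^ 2 / (4 * l))) y :=
  intervalIntegral.integral_hasDerivAt_right ((PhiF_cont l).intervalIntegrable _ _)
    ((PhiF_cont l).stronglyMeasurableAtFilter _ _) (PhiF_cont l).continuousAt

lemma PhiF_continuous (l : ℝ) : Continuous (PhiF l) :=
  continuous_iff_continuousAt.2 fun y => (PhiF_hasDerivAt l y).continuousAt

lemma PhiF_mono (l : ℝ) : Monotone (PhiF l) :=
  monotone_of_hasDerivAt_nonneg (fun y => PhiF_hasDerivAt l y) (fun y => (Real.exp_pos _).le)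

lemma PhiF_diff (l a b : ℝ) (hl : 0 < l) (ha : 0 ≤ a) (hab : a ≤ b) :
    (b - a) * Real.exp (-b ^ 2 / (4 * l)) ≤ PhiF l b - PhiF l a := by
  have h1 : PhiF l b - PhiF l a = ∫ z in a..b, Real.exp (-z ^ 2 / (4 * l)) := by
    unfold PhiF
    rw [intervalIntegral.integral_interval_sub_left] <;>
      exact (PhiF_cont l).intervalIntegrable _ _
  rw [h1]
  have h2 : ∫ z in a..b, Real.exp (-b ^ 2 / (4 * l)) ≤ ∫ z in a..b, Real.exp (-z ^ 2 / (4 * l)) := by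
    refine intervalIntegral.integral_mono_on hab (by simp) ((PhiF_cont l).intervalIntegrable _ _) ?_
    intro z hz
    refine Real.exp_le_exp.2 ?_
    refine div_le_div_of_nonneg_right ?_ (by positivity)
    have : z ^ 2 ≤ b ^ 2 := pow_le_pow_left₀ (ha.trans hz.1) hz.2 2
    linarith
  simpa using h2

namespace CFlow

variable {M : ℝ} {X Y g c s k : ℝ → ℝ → ℝ}

/-- the slice inclusion in the first variable is continuous -/
lemma cont_u {F : ℝ → ℝ → ℝ} {t : ℝ}
    (hF : ∀ u, ContinuousAt (fun p : ℝ × ℝ => F p.1 p.2) (u, t)) : Continuous (fun u => F u t) := by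
  refine continuous_iff_continuousAt.2 fun u => ?_
  exact ContinuousAt.comp (f := fun v : ℝ => ((v, t) : ℝ × ℝ)) (hF u) (by fun_prop)

lemma cont_t {F : ℝ → ℝ → ℝ} {u a b : ℝ} (hb : b < 0)
    (hF : ∀ t, t < 0 → ContinuousAt (fun p : ℝ × ℝ => F p.1 p.2) (u, t)) :
    ContinuousOn (fun t => F u t) (Icc a b) := by
  intro t ht
  refine ContinuousAt.continuousWithinAt ?_
  exact ContinuousAt.comp (f := fun v : ℝ => ((u, v) : ℝ × ℝ)) (hF t (lt_of_le_of_lt ht.2 hb))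
    (by fun_prop)

lemma gcont (h : CFlow M X Y g c s k) {t : ℝ} (ht : t < 0) : Continuous (fun u => g u t) :=
  cont_u fun u => (h.dg u t ht).continuousAt
lemma Xcont (h : CFlow M X Y g c s k) {t : ℝ} (ht : t < 0) : Continuous (fun u => X u t) :=
  cont_u fun u => (h.dX u t ht).continuousAt
lemma Ycont (h : CFlow M X Y g c s k) {t : ℝ} (ht : t < 0) : Continuous (fun u => Y u t) :=
  cont_u fun u => (h.dY u t ht).continuousAt
lemma zcont (h : CFlow M X Y g c s k) {t : ℝ} (ht : t < 0) :
    Continuous (fun u => zF X Y c s u t) :=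
  cont_u fun u => (h.dz u t ht).continuousAt
lemma wcont (h : CFlow M X Y g c s k) {t : ℝ} (ht : t < 0) :
    Continuous (fun u => wF X Y c s u t) :=
  cont_u fun u => (h.dw u t ht).continuousAt
lemma rhocont (h : CFlow M X Y g c s k) {t : ℝ} (ht : t < 0) : Continuous (fun u => rhoF X Y u t) :=
  cont_u fun u => (h.drho u t ht).continuousAt
lemma vcont (h : CFlow M X Y g c s k) {t : ℝ} (ht : t < 0) :
    Continuous (fun u => vF X Y c s k u t) :=
  cont_u fun u => h.cv u t ht

/-- derivative of the squared radius -/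
lemma r2_u (h : CFlow M X Y g c s k) (u t : ℝ) (ht : t < 0) :
    HasDerivAt (fun v => X v t ^ 2 + Y v t ^ 2) (2 * g u t * zF X Y c s u t) u := by
  have h3 := ((h.Xu u t ht).pow 2).add ((h.Yu u t ht).pow 2)
  refine h3.congr_deriv ?_
  simp only [zF]
  simp
  ring

/-- the flux is small far out -/
lemma B_bound (h : CFlow M X Y g c s k) (u t : ℝ) (ht : t < 0) :
    |BF X Y c s u t| ≤ Real.exp (-(X u t ^ 2 + Y u t ^ 2) / (8 * (-t))) / (-t) := by
  have hτ : 0 < -t := by linarith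
  have hzw := h.zw u t ht
  set z := zF X Y c s u t
  set w := wF X Y c s u t
  have hz : z ^ 2 ≤ X u t ^ 2 + Y u t ^ 2 := by nlinarith [sq_nonneg w]
  set r := X u t ^ 2 + Y u t ^ 2
  set τ := -t
  have hS := Real.sqrt_pos.2 hτ
  have hS2 := Real.sq_sqrt hτ.le
  set S := Real.sqrt τ
  have key : |z| ≤ 2 * S * Real.exp (r / (8 * τ)) := by
    have h1 : 1 + r / (8 * τ) ≤ Real.exp (r / (8 * τ)) := by
      have := Real.add_one_le_exp (r / (8 * τ)); linarith
    have h2 : |z| ≤ 2 * S * (1 + r / (8 * τ)) := by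
      have h3 : |z| * (4 * S) ≤ 8 * S ^ 2 + r := by
        nlinarith [sq_nonneg (|z| - 2 * S), sq_abs z]
      have : 2 * S * (1 + r / (8 * τ)) = (8 * S ^ 2 + r) / (4 * S) := by
        rw [← hS2]; field_simp; ring
      rw [this, le_div_iff₀ (by positivity)]
      exact h3
    exact h2.trans (mul_le_mul_of_nonneg_left h1 (by positivity))
  have e1 : |BF X Y c s u t| = |z| * Real.exp (-r / (4 * τ)) / S / (2 * τ) := by
    simp only [BF, rhoF]
    rw [abs_div, abs_mul, abs_div, abs_of_pos (Real.exp_pos _), abs_of_pos hS,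
      abs_of_pos (by positivity : 0 < 2 * -t)]
    simp only [mul_div_assoc]; rfl
  rw [e1]
  have e2 : Real.exp (-r / (4 * τ)) = Real.exp (-r / (8 * τ)) * Real.exp (-r / (8 * τ)) := by
    rw [← Real.exp_add]; congr 1; field_simp; ring
  have e3 : Real.exp (r / (8 * τ)) * Real.exp (-r / (8 * τ)) = 1 := by
    rw [← Real.exp_add]; rw [neg_div]; simp
  rw [e2, div_div, div_le_div_iff₀ (by positivity) hτ]
  have hE := Real.exp_pos (-r / (8 * τ))
  set E := Real.exp (-r / (8 * τ))
  have : |z| * E ≤ 2 * S := by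
    calc |z| * E ≤ 2 * S * Real.exp (r / (8 * τ)) * E := mul_le_mul_of_nonneg_right key hE.le
      _ = 2 * S := by rw [mul_assoc, e3, mul_one]
  calc |z| * (E * E) * τ = (|z| * E) * (E * τ) := by ring
    _ ≤ 2 * S * (E * τ) := mul_le_mul_of_nonneg_right this (by positivity)
    _ = E * (S * (2 * τ)) := by ring

lemma B_int (h : CFlow M X Y g c s k) (u t₁ t₂ : ℝ) (h12 : t₁ ≤ t₂) (h2 : t₂ < 0) :
    IntervalIntegrable (fun t => BF X Y c s u t) volume t₁ t₂ := by
  refine ContinuousOn.intervalIntegrable ?_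
  rw [uIcc_of_le h12]
  exact cont_t h2 fun t ht => (h.dB u t ht).continuousAt

/-- decay of the flux -/
lemma flux_small (h : CFlow M X Y g c s k) (t₁ t₂ : ℝ) (h12 : t₁ ≤ t₂) (h2 : t₂ < 0) (ε : ℝ)
    (hε : 0 < ε) : ∃ U : ℝ, ∀ u, U ≤ |u| → ∫ t in t₁..t₂, |BF X Y c s u t| ≤ ε := by
  have hT : Tendsto (fun u => ∫ t in t₁..t₂, |BF X Y c s u t|) (comap (fun u : ℝ => |u|) atTop)
      (nhds (∫ t in t₁..t₂, (0 : ℝ))) := by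
    refine intervalIntegral.tendsto_integral_filter_of_dominated_convergence
      (fun _ => 1 / (-t₂)) ?_ ?_ ?_ ?_
    · refine Eventually.of_forall fun u => ?_
      exact (intervalIntegrable_iff.1 (h.B_int u t₁ t₂ h12 h2).abs).aestronglyMeasurable
    · refine Eventually.of_forall fun u => Eventually.of_forall fun t ht => ?_
      rw [uIoc_of_le h12] at ht
      have ht0 : t < 0 := lt_of_le_of_lt ht.2 h2
      rw [Real.norm_eq_abs, abs_abs]
      refine (h.B_bound u t ht0).trans ?_
      have : Real.exp (-(X u t ^ 2 + Y u t ^ 2) / (8 * (-t))) ≤ 1 := by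
        refine Real.exp_le_one_iff.2 ?_
        rw [neg_div]
        have : 0 < -t := by linarith
        have : 0 ≤ (X u t ^ 2 + Y u t ^ 2) / (8 * (-t)) := by positivity
        linarith
      exact div_le_div₀ zero_le_one this (by linarith) (by linarith [ht.2])
    · simp
    · refine Eventually.of_forall fun t ht => ?_
      rw [uIoc_of_le h12] at ht
      have ht0 : t < 0 := lt_of_le_of_lt ht.2 h2
      have hτ : 0 < -t := by linarith
      have hr : Tendsto (fun u => X u t ^ 2 + Y u t ^ 2) (comap (fun u : ℝ => |u|) atTop) atTop := by
        refine tendsto_atTop.2 fun R => ?_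
        obtain ⟨U, hU⟩ := h.proper t ht0 R
        have : ∀ᶠ u in comap (fun u : ℝ => |u|) atTop, U ≤ |u| :=
          tendsto_comap.eventually (eventually_ge_atTop U)
        exact this.mono hU
      have h3 : Tendsto (fun u => Real.exp (-(X u t ^ 2 + Y u t ^ 2) / (8 * (-t))) / (-t))
          (comap (fun u : ℝ => |u|) atTop) (nhds (0 / (-t))) := by
        refine Tendsto.div_const ?_ _
        refine Real.tendsto_exp_atBot.comp ?_
        refine Tendsto.atBot_div_const (by positivity) ?_
        exact tendsto_neg_atTop_atBot.comp hr
      rw [zero_div] at h3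
      exact squeeze_zero (fun u => abs_nonneg _) (fun u => h.B_bound u t ht0) h3
  simp only [intervalIntegral.integral_zero] at hT
  have hev := (tendsto_order.1 hT).2 ε hε
  rw [eventually_comap] at hev
  obtain ⟨U, hU⟩ := eventually_atTop.1 hev
  exact ⟨U, fun u hu => (hU |u| hu u rfl).le⟩

/-- radial lower bound for Gaussian length -/
lemma lemL (h : CFlow M X Y g c s k) (t : ℝ) (ht : t < 0) (l : ℝ) (hl : 0 < l) (a b : ℝ)
    (hab : a ≤ b) :
    |PhiF l (Real.sqrt (X b t ^ 2 + Y b t ^ 2)) - PhiF l (Real.sqrt (X a t ^ 2 + Y a t ^ 2))| ≤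
      ∫ u in a..b, Real.exp (-(X u t ^ 2 + Y u t ^ 2) / (4 * l)) * g u t := by
  have hXc := h.Xcont ht
  have hYc := h.Ycont ht
  have hgc := h.gcont ht
  have main : ∀ δ : ℝ, 0 < δ →
      |PhiF l (Real.sqrt (X b t ^ 2 + Y b t ^ 2 + δ)) -
        PhiF l (Real.sqrt (X a t ^ 2 + Y a t ^ 2 + δ))| ≤
      ∫ u in a..b, Real.exp (-(X u t ^ 2 + Y u t ^ 2) / (4 * l)) * g u t := by
    intro δ hδ
    have hder : ∀ u, HasDerivAt (fun v => PhiF l (Real.sqrt (X v t ^ 2 + Y v t ^ 2 + δ)))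
        (Real.exp (-(Real.sqrt (X u t ^ 2 + Y u t ^ 2 + δ)) ^ 2 / (4 * l)) *
          ((2 * g u t * zF X Y c s u t) / (2 * Real.sqrt (X u t ^ 2 + Y u t ^ 2 + δ)))) u := by
      intro u
      have h1 : HasDerivAt (fun v => X v t ^ 2 + Y v t ^ 2 + δ) (2 * g u t * zF X Y c s u t) u :=
        (h.r2_u u t ht).add_const δ
      have h2 := h1.sqrt (by positivity)
      exact (PhiF_hasDerivAt l _).comp u h2
    have hzc := h.zcont ht
    have hcont : Continuous (fun u => Real.exp (-(Real.sqrt (X u t ^ 2 + Y u t ^ 2 + δ)) ^ 2 / (4 * l)) *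
          ((2 * g u t * zF X Y c s u t) / (2 * Real.sqrt (X u t ^ 2 + Y u t ^ 2 + δ)))) := by
      have : ∀ u, 2 * Real.sqrt (X u t ^ 2 + Y u t ^ 2 + δ) ≠ 0 := fun u => by
        have : 0 < X u t ^ 2 + Y u t ^ 2 + δ := by positivity
        have := Real.sqrt_pos.2 this
        positivity
      fun_prop (disch := exact this)
    rw [← intervalIntegral.integral_eq_sub_of_hasDerivAt (fun u _ => hder u)
      (hcont.intervalIntegrable _ _)]
    refine (intervalIntegral.abs_integral_le_integral_abs hab).trans ?_
    refine intervalIntegral.integral_mono_on hab (hcont.abs.intervalIntegrable _ _) ?_ ?_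
    · exact Continuous.intervalIntegrable (by fun_prop) _ _
    intro u _
    have hg := h.gpos u t ht
    have hr : 0 < X u t ^ 2 + Y u t ^ 2 + δ := by positivity
    have hS := Real.sqrt_pos.2 hr
    have hS2 := Real.sq_sqrt hr.le
    rw [abs_mul, abs_of_pos (Real.exp_pos _), hS2]
    refine mul_le_mul ?_ ?_ (abs_nonneg _) (Real.exp_pos _).le
    · refine Real.exp_le_exp.2 (div_le_div_of_nonneg_right ?_ (by positivity))
      linarith
    · set S := Real.sqrt (X u t ^ 2 + Y u t ^ 2 + δ)
      rw [abs_div, abs_of_pos (by positivity : 0 < 2 * S), abs_mul,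
        abs_of_pos (by positivity : 0 < 2 * g u t), div_le_iff₀ (by positivity)]
      have hz : |zF X Y c s u t| ≤ S := by
        refine abs_le_of_sq_le_sq ?_ hS.le
        have := h.zw u t ht
        nlinarith [sq_nonneg (wF X Y c s u t)]
      nlinarith
  have hT : Tendsto (fun δ : ℝ => |PhiF l (Real.sqrt (X b t ^ 2 + Y b t ^ 2 + δ)) -
        PhiF l (Real.sqrt (X a t ^ 2 + Y a t ^ 2 + δ))|) (nhdsWithin 0 (Ioi 0))
      (nhds |PhiF l (Real.sqrt (X b t ^ 2 + Y b t ^ 2 + 0)) -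
        PhiF l (Real.sqrt (X a t ^ 2 + Y a t ^ 2 + 0))|) := by
    have hP := PhiF_continuous l
    have : Continuous (fun δ : ℝ => |PhiF l (Real.sqrt (X b t ^ 2 + Y b t ^ 2 + δ)) -
        PhiF l (Real.sqrt (X a t ^ 2 + Y a t ^ 2 + δ))|) := by fun_prop
    exact (this.tendsto 0).mono_left nhdsWithin_le_nhds
  simp only [add_zero] at hT
  refine le_of_tendsto hT ?_
  filter_upwards [self_mem_nhdsWithin] with δ hδ using main δ hδ

end CFlow

namespace CFlow

variable {M : ℝ} {X Y g c s k : ℝ → ℝ → ℝ}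

lemma mass_cont (h : CFlow M X Y g c s k) {t : ℝ} (ht : t < 0) :
    Continuous (fun u => rhoF X Y u t * g u t) := (h.rhocont ht).mul (h.gcont ht)

lemma mass_nonneg (h : CFlow M X Y g c s k) {t : ℝ} (ht : t < 0) (u : ℝ) :
    0 ≤ rhoF X Y u t * g u t := (mul_pos (rho_pos u t ht) (h.gpos u t ht)).le

lemma mass_sub (h : CFlow M X Y g c s k) {t : ℝ} (ht : t < 0) {a b a' b' : ℝ}
    (h1 : a ≤ a') (h2 : a' ≤ b') (h3 : b' ≤ b) :
    ∫ u in a'..b', rhoF X Y u t * g u t ≤ ∫ u in a..b, rhoF X Y u t * g u t := by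
  refine intervalIntegral.integral_mono_interval h1 h2 h3 ?_ ((h.mass_cont ht).intervalIntegrable _ _)
  exact Eventually.of_forall fun u => h.mass_nonneg ht u

lemma mass_eq (t a b : ℝ) :
    ∫ u in a..b, rhoF X Y u t * g u t =
      (∫ u in a..b, Real.exp (-(X u t ^ 2 + Y u t ^ 2) / (4 * (-t))) * g u t) / Real.sqrt (-t) := by
  rw [← intervalIntegral.integral_div]
  congr 1; ext u; simp only [rhoF]; ring

lemma mass_le (h : CFlow M X Y g c s k) {t : ℝ} (ht : t < 0) {a b : ℝ} (hab : a ≤ b) :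
    ∫ u in a..b, rhoF X Y u t * g u t ≤ M := by
  have hτ : 0 < -t := by linarith
  rw [mass_eq, div_le_iff₀ (Real.sqrt_pos.2 hτ)]
  exact h.ent t ht _ hτ a b hab

/-- the tails of the Gaussian mass are small -/
lemma tail_small (h : CFlow M X Y g c s k) {t : ℝ} (ht : t < 0) {ε : ℝ} (hε : 0 < ε) :
    ∃ U : ℝ, 0 ≤ U ∧ (∀ a b, U ≤ a → a ≤ b → ∫ u in a..b, rhoF X Y u t * g u t ≤ ε) ∧
      (∀ a b, a ≤ b → b ≤ -U → ∫ u in a..b, rhoF X Y u t * g u t ≤ ε) := by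
  set F : ℝ → ℝ := fun n => ∫ u in (-n)..n, rhoF X Y u t * g u t with hF
  have hii : ∀ a b, IntervalIntegrable (fun u => rhoF X Y u t * g u t) volume a b :=
    fun a b => (h.mass_cont ht).intervalIntegrable a b
  have hbdd : BddAbove (Set.image F (Ici 0)) := by
    refine ⟨M, ?_⟩
    rintro _ ⟨n, hn, rfl⟩
    exact h.mass_le ht (by simp only [mem_Ici] at hn; linarith)
  have hne : (Set.image F (Ici 0)).Nonempty := ⟨F 0, 0, by simp, rfl⟩
  obtain ⟨_, ⟨U, hU, rfl⟩, hlt⟩ := exists_lt_of_lt_csSup hne (sub_lt_self (sSup (Set.image F (Ici 0))) hε)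
  simp only [mem_Ici] at hU
  refine ⟨U, hU, ?_, ?_⟩
  · intro a b ha hab
    have h1 : F b ≤ sSup (Set.image F (Ici 0)) := le_csSup hbdd ⟨b, by simp only [mem_Ici]; linarith, rfl⟩
    have h2 : (∫ u in (-b)..(-U), rhoF X Y u t * g u t) + F U +
        (∫ u in U..a, rhoF X Y u t * g u t) + (∫ u in a..b, rhoF X Y u t * g u t) = F b := by
      simp only [hF]
      rw [intervalIntegral.integral_add_adjacent_intervals (hii _ _) (hii _ _),
        intervalIntegral.integral_add_adjacent_intervals (hii _ _) (hii _ _),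
        intervalIntegral.integral_add_adjacent_intervals (hii _ _) (hii _ _)]
    have h3 := intervalIntegral.integral_nonneg (μ := volume) (show -b ≤ -U by linarith)
      (fun u _ => h.mass_nonneg ht u)
    have h4 := intervalIntegral.integral_nonneg (μ := volume) ha
      (fun u _ => h.mass_nonneg ht u)
    linarith
  · intro a b hab hb
    have h1 : F (-a) ≤ sSup (Set.image F (Ici 0)) := le_csSup hbdd ⟨-a, by simp only [mem_Ici]; linarith, rfl⟩
    have h2 : (∫ u in a..b, rhoF X Y u t * g u t) + (∫ u in b..(-U), rhoF X Y u t * g u t) + F U +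
        (∫ u in U..(-a), rhoF X Y u t * g u t) = F (-a) := by
      simp only [hF]
      rw [intervalIntegral.integral_add_adjacent_intervals (hii _ _) (hii _ _),
        intervalIntegral.integral_add_adjacent_intervals (hii _ _) (hii _ _),
        intervalIntegral.integral_add_adjacent_intervals (hii _ _) (hii _ _), neg_neg]
    have h3 := intervalIntegral.integral_nonneg (μ := volume) hb
      (fun u _ => h.mass_nonneg ht u)
    have h4 := intervalIntegral.integral_nonneg (μ := volume) (show U ≤ -a by linarith)
      (fun u _ => h.mass_nonneg ht u)
    linarith

lemma dissip_nonneg (h : CFlow M X Y g c s k) (a b t₁ t₂ : ℝ) (hab : a ≤ b) (ht : t₁ ≤ t₂)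
    (ht2 : t₂ < 0) :
    0 ≤ (∫ u in a..b, ∫ t in t₁..t₂, rhoF X Y u t * g u t * vF X Y c s k u t ^ 2) := by
  refine intervalIntegral.integral_nonneg hab fun u _ =>
    intervalIntegral.integral_nonneg ht fun t htt => ?_
  have : t < 0 := lt_of_le_of_lt htt.2 ht2
  exact mul_nonneg (h.mass_nonneg this u) (sq_nonneg _)

lemma flux_le (h : CFlow M X Y g c s k) {t₁ t t₂ u : ℝ} (h1 : t₁ ≤ t) (h2 : t ≤ t₂) (h0 : t₂ < 0) :
    |∫ r in t₁..t, BF X Y c s u r| ≤ ∫ r in t₁..t₂, |BF X Y c s u r| := by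
  refine (intervalIntegral.abs_integral_le_integral_abs h1).trans ?_
  refine intervalIntegral.integral_mono_interval le_rfl h1 h2
    (Eventually.of_forall fun u => abs_nonneg _) (h.B_int u t₁ t₂ (h1.trans h2) h0).abs

/-- uniform properness on compact time intervals -/
lemma uproper (h : CFlow M X Y g c s k) (t₁ t₀ : ℝ) (h10 : t₁ ≤ t₀) (h0 : t₀ < 0) (R : ℝ) :
    ∃ U : ℝ, ∀ u, U ≤ |u| → ∀ t ∈ Icc t₁ t₀, R ≤ X u t ^ 2 + Y u t ^ 2 := by
  wlog hR : 0 < R generalizing R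
  · obtain ⟨U, hU⟩ := this 1 one_pos
    exact ⟨U, fun u hu t ht => by linarith [hU u hu t ht]⟩
  have hτ1 : 0 < -t₁ := by linarith
  have hτ0 : 0 < -t₀ := by linarith
  set C : ℝ := Real.sqrt R * Real.exp (-R / (-t₀)) / Real.sqrt (-t₁) with hC
  have hCpos : 0 < C := by
    have := Real.sqrt_pos.2 hR
    have := Real.sqrt_pos.2 hτ1
    positivity
  obtain ⟨U₁, hU₁0, hU₁, hU₁'⟩ := h.tail_small (show t₁ < 0 by linarith) (show 0 < C / 4 by positivity)
  obtain ⟨U₂, hU₂⟩ := h.flux_small t₁ t₀ h10 h0 (C / 4) (by positivity)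
  -- lower bound of mass
  have low : ∀ t ∈ Icc t₁ t₀, ∀ a b, a ≤ b →
      (X a t ^ 2 + Y a t ^ 2 < R ∧ 4 * R ≤ X b t ^ 2 + Y b t ^ 2 ∨
        X b t ^ 2 + Y b t ^ 2 < R ∧ 4 * R ≤ X a t ^ 2 + Y a t ^ 2) →
      C ≤ ∫ u in a..b, rhoF X Y u t * g u t := by
    intro t ht a b hab hor
    have ht0 : t < 0 := lt_of_le_of_lt ht.2 h0
    have hτ : 0 < -t := by linarith
    rw [mass_eq]
    have hL := h.lemL t ht0 (-t) hτ a b hab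
    have hs4 : Real.sqrt (4 * R) = 2 * Real.sqrt R := by
      rw [Real.sqrt_mul (by norm_num)]; congr 1
      rw [show (4 : ℝ) = 2 ^ 2 by norm_num]; exact Real.sqrt_sq (by norm_num)
    have hd := PhiF_diff (-t) (Real.sqrt R) (Real.sqrt (4 * R)) hτ (Real.sqrt_nonneg _)
      (Real.sqrt_le_sqrt (by linarith))
    rw [Real.sq_sqrt (by positivity : 0 ≤ 4 * R), hs4] at hd
    have hm : ∀ x y : ℝ, x < R → 4 * R ≤ y → PhiF (-t) (2 * Real.sqrt R) - PhiF (-t) (Real.sqrt R) ≤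
        PhiF (-t) (Real.sqrt y) - PhiF (-t) (Real.sqrt x) := by
      intro x y hx hy
      rw [← hs4]
      have := PhiF_mono (-t) (Real.sqrt_le_sqrt hy)
      have := PhiF_mono (-t) (Real.sqrt_le_sqrt hx.le)
      linarith
    have hge : PhiF (-t) (2 * Real.sqrt R) - PhiF (-t) (Real.sqrt R) ≤
        ∫ u in a..b, Real.exp (-(X u t ^ 2 + Y u t ^ 2) / (4 * (-t))) * g u t := by
      refine le_trans ?_ hL
      rcases hor with ⟨ha, hb⟩ | ⟨hb, ha⟩
      · exact (hm _ _ ha hb).trans (le_abs_self _)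
      · rw [abs_sub_comm]
        exact (hm _ _ hb ha).trans (le_abs_self _)
    have hexp : Real.exp (-R / (-t₀)) ≤ Real.exp (-(4 * R) / (4 * (-t))) := by
      refine Real.exp_le_exp.2 ?_
      rw [neg_mul_eq_mul_neg, mul_div_mul_left _ _ (by norm_num : (4 : ℝ) ≠ 0), neg_div, neg_div]
      have : R / (-t) ≤ R / (-t₀) := div_le_div_of_nonneg_left hR.le hτ0 (by linarith [ht.2])
      linarith
    have hsR := Real.sqrt_pos.2 hR
    have : Real.sqrt R * Real.exp (-R / (-t₀)) ≤
        ∫ u in a..b, Real.exp (-(X u t ^ 2 + Y u t ^ 2) / (4 * (-t))) * g u t := by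
      refine le_trans ?_ (hd.trans hge)
      rw [show 2 * Real.sqrt R - Real.sqrt R = Real.sqrt R by ring]
      exact mul_le_mul_of_nonneg_left hexp hsR.le
    refine div_le_div₀ ?_ this (Real.sqrt_pos.2 hτ) (Real.sqrt_le_sqrt (by linarith [ht.1]))
    exact le_trans (by positivity) this
  -- upper bound
  have up : ∀ t ∈ Icc t₁ t₀, ∀ a b, a ≤ b → U₂ ≤ |a| → U₂ ≤ |b| → (U₁ ≤ a ∨ b ≤ -U₁) →
      ∫ u in a..b, rhoF X Y u t * g u t ≤ 3 * (C / 4) := by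
    intro t ht a b hab hUa hUb hor
    have ht0 : t < 0 := lt_of_le_of_lt ht.2 h0
    have hmon := h.monotonicity a b t₁ t ht.1 ht0
    have hdis := h.dissip_nonneg a b t₁ t hab ht.1 ht0
    have hfa := (abs_le.1 ((h.flux_le (u := a) ht.1 ht.2 h0).trans (hU₂ a hUa))).1
    have hfb := (abs_le.1 ((h.flux_le (u := b) ht.1 ht.2 h0).trans (hU₂ b hUb))).2
    have hta : ∫ u in a..b, rhoF X Y u t₁ * g u t₁ ≤ C / 4 := by
      rcases hor with ho | ho
      · exact hU₁ a b ho hab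
      · exact hU₁' a b hab ho
    linarith
  refine ⟨max U₁ U₂, fun u hu t ht => ?_⟩
  by_contra hlt
  push Not at hlt
  have ht0 : t < 0 := lt_of_le_of_lt ht.2 h0
  obtain ⟨V, hV⟩ := h.proper t ht0 (4 * R)
  have hu1 : U₁ ≤ |u| := (le_max_left _ _).trans hu
  have hu2 : U₂ ≤ |u| := (le_max_right _ _).trans hu
  rcases le_total 0 u with hpos | hneg
  · set b := max u V
    have hb0 : 0 ≤ b := hpos.trans (le_max_left _ _)
    have hub : u ≤ b := le_max_left _ _
    rw [abs_of_nonneg hpos] at hu1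
    have e1 := low t ht u b hub (Or.inl ⟨hlt, hV b (by rw [abs_of_nonneg hb0]; exact le_max_right _ _)⟩)
    have e2 := up t ht u b hub hu2 (by
      rw [abs_of_nonneg hpos] at hu2; rw [abs_of_nonneg hb0]; linarith) (Or.inl hu1)
    linarith
  · set b := min u (-V)
    have hb0 : b ≤ 0 := (min_le_left _ _).trans hneg
    have hub : b ≤ u := min_le_left _ _
    rw [abs_of_nonpos hneg] at hu1
    have e1 := low t ht b u hub (Or.inr ⟨hlt, hV b (by
      rw [abs_of_nonpos hb0]; have : b ≤ -V := min_le_right _ _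
      linarith)⟩)
    have e2 := up t ht b u hub (by
      rw [abs_of_nonpos hneg] at hu2; rw [abs_of_nonpos hb0]; linarith) hu2 (Or.inr (by linarith))
    linarith

end CFlow

/-- admissible alternating chains at time `t` -/
def chainSet (N : ℕ) (U t₀ ε : ℝ) (a : ℕ → ℝ) (f : ℝ → ℝ → ℝ) (t : ℝ) : Set (ℕ → ℝ) :=
  {w | (∀ i, w i ∈ Icc (-U) U) ∧ w 0 = -U ∧ w N = U ∧ (∀ i, i < N → w i ≤ w (i + 1)) ∧
    ∀ i, i ≤ N → (-1) ^ i * a i - ε * (t₀ - t) ≤ (-1) ^ i * f (w i) t}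

lemma chainSet_compact (N : ℕ) (U t₀ t₁ ε : ℝ) (a : ℕ → ℝ) (f : ℝ → ℝ → ℝ)
    (hf : Continuous (fun p : ℝ × ℝ => f p.1 p.2)) :
    IsCompact {p : (ℕ → ℝ) × ℝ | p.2 ∈ Icc t₁ t₀ ∧ p.1 ∈ chainSet N U t₀ ε a f p.2} := by
  have hbox : IsCompact ((univ.pi fun _ : ℕ => Icc (-U) U) ×ˢ Icc t₁ t₀) :=
    (isCompact_univ_pi fun _ => isCompact_Icc).prod isCompact_Icc
  have hcl : IsClosed {p : (ℕ → ℝ) × ℝ | p.1 0 = -U ∧ p.1 N = U ∧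
      (∀ i, i < N → p.1 i ≤ p.1 (i + 1)) ∧
      ∀ i, i ≤ N → (-1) ^ i * a i - ε * (t₀ - p.2) ≤ (-1) ^ i * f (p.1 i) p.2} := by
    have hproj : ∀ i : ℕ, Continuous (fun p : (ℕ → ℝ) × ℝ => p.1 i) := fun i => by fun_prop
    refine IsClosed.and ?_ (IsClosed.and ?_ (IsClosed.and ?_ ?_))
    · exact isClosed_eq (hproj 0) continuous_const
    · exact isClosed_eq (hproj N) continuous_const
    · simp only [setOf_forall]
      exact isClosed_iInter fun i => isClosed_iInter fun _ => isClosed_le (hproj i) (hproj (i + 1))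
    · simp only [setOf_forall]
      refine isClosed_iInter fun i => isClosed_iInter fun _ => isClosed_le (by fun_prop) ?_
      have : Continuous (fun p : (ℕ → ℝ) × ℝ => f (p.1 i) p.2) :=
        hf.comp ((hproj i).prodMk continuous_snd)
      fun_prop
  convert hbox.inter_right hcl using 1
  ext p
  simp only [chainSet, mem_setOf_eq, mem_inter_iff, mem_prod, mem_univ_pi]
  tauto

lemma chainSet_max (N : ℕ) (U t₀ t ε : ℝ) (a : ℕ → ℝ) (f : ℝ → ℝ → ℝ)
    (hf : Continuous (fun p : ℝ × ℝ => f p.1 p.2))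
    (hgap : ∀ i, i < N → 2 * (ε * (t₀ - t)) < (-1) ^ i * (a i - a (i + 1)))
    (hne : (chainSet N U t₀ ε a f t).Nonempty) :
    ∃ w ∈ chainSet N U t₀ ε a f t, ∀ i, 0 < i → i < N →
      IsLocalMax (fun v => (-1) ^ i * f v t) (w i) := by
  have hft : Continuous (fun v => f v t) := hf.comp (by fun_prop : Continuous fun v : ℝ => (v, t))
  have hcomp : IsCompact (chainSet N U t₀ ε a f t) := by
    have hbox : IsCompact (univ.pi fun _ : ℕ => Icc (-U) U) :=
      (isCompact_univ_pi fun _ => isCompact_Icc)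
    refine hbox.of_isClosed_subset ?_ (fun w hw => fun i _ => hw.1 i)
    have hproj : ∀ i : ℕ, Continuous (fun p : (ℕ → ℝ) => p i) := fun i => by fun_prop
    have : chainSet N U t₀ ε a f t = (univ.pi fun _ : ℕ => Icc (-U) U) ∩ {w | w 0 = -U ∧ w N = U ∧
        (∀ i, i < N → w i ≤ w (i + 1)) ∧
        ∀ i, i ≤ N → (-1) ^ i * a i - ε * (t₀ - t) ≤ (-1) ^ i * f (w i) t} := by
      ext w
      simp only [chainSet, mem_setOf_eq, mem_inter_iff, mem_univ_pi]
    rw [this]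
    refine hbox.isClosed.inter (IsClosed.and ?_ (IsClosed.and ?_ (IsClosed.and ?_ ?_)))
    · exact isClosed_eq (hproj 0) continuous_const
    · exact isClosed_eq (hproj N) continuous_const
    · simp only [setOf_forall]
      exact isClosed_iInter fun i => isClosed_iInter fun _ => isClosed_le (hproj i) (hproj (i + 1))
    · simp only [setOf_forall]
      refine isClosed_iInter fun i => isClosed_iInter fun _ => isClosed_le (by fun_prop) ?_
      exact continuous_const.mul (hft.comp (hproj i))
  have hS : Continuous (fun w : ℕ → ℝ => ∑ j ∈ Finset.range (N + 1), (-1) ^ j * f (w j) t) := by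
    refine continuous_finsetSum _ fun j _ => continuous_const.mul (hft.comp (continuous_apply j))
  obtain ⟨w, hw, hmax⟩ := hcomp.exists_isMaxOn hne hS.continuousOn
  refine ⟨w, hw, fun i hi0 hiN => ?_⟩
  obtain ⟨hbox, h0, hN, hmono, hval⟩ := hw
  have hsq : ∀ i : ℕ, ((-1 : ℝ) ^ i) * ((-1 : ℝ) ^ i) = 1 := fun i => by
    rw [← mul_pow]; norm_num
  have hstrict : ∀ j, j < N → w j < w (j + 1) := by
    intro j hj
    refine lt_of_le_of_ne (hmono j hj) fun he => ?_
    have h1 := hval j hj.le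
    have h2 := hval (j + 1) hj
    rw [← he, pow_succ] at h2
    have h3 := hgap j hj
    linarith
  obtain ⟨j, rfl⟩ : ∃ j, i = j + 1 := ⟨i - 1, by omega⟩
  have hl := hstrict j (by omega)
  have hr := hstrict (j + 1) hiN
  have hnb : Ioo (w j) (w (j + 1 + 1)) ∈ nhds (w (j + 1)) := Ioo_mem_nhds hl hr
  refine Filter.mem_of_superset hnb fun v hv => ?_
  simp only [mem_setOf_eq]
  by_contra hlt
  push Not at hlt
  have hmem : Function.update w (j + 1) v ∈ chainSet N U t₀ ε a f t := by
    refine ⟨fun q => ?_, ?_, ?_, fun q hq => ?_, fun q hq => ?_⟩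
    · by_cases hq : q = j + 1
      · subst hq
        rw [Function.update_self]
        exact ⟨(hbox j).1.trans hv.1.le, hv.2.le.trans (hbox (j + 1 + 1)).2⟩
      · rw [Function.update_of_ne hq]; exact hbox q
    · rw [Function.update_of_ne (by omega)]; exact h0
    · rw [Function.update_of_ne (by omega)]; exact hN
    · by_cases h1 : q = j + 1
      · subst h1
        rw [Function.update_self, Function.update_of_ne (by omega)]
        exact hv.2.le
      · rw [Function.update_of_ne h1]
        by_cases h2 : q = j
        · subst h2
          rw [Function.update_self]; exact hv.1.le
        · rw [Function.update_of_ne (by omega)]; exact hmono q hq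
    · by_cases h1 : q = j + 1
      · subst h1
        rw [Function.update_self]
        exact (hval _ hq).trans hlt.le
      · rw [Function.update_of_ne h1]; exact hval q hq
  have hle := hmax hmem
  simp only [mem_setOf_eq] at hle
  have hi : j + 1 ∈ Finset.range (N + 1) := by simp; omega
  rw [← Finset.add_sum_erase _ _ hi, ← Finset.add_sum_erase _ _ hi, Function.update_self] at hle
  have : ∑ x ∈ (Finset.range (N + 1)).erase (j + 1), (-1) ^ x * f (Function.update w (j + 1) v x) t =
      ∑ x ∈ (Finset.range (N + 1)).erase (j + 1), (-1) ^ x * f (w x) t := by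
    refine Finset.sum_congr rfl fun x hx => ?_
    rw [Function.update_of_ne (Finset.ne_of_mem_erase hx)]
  rw [this] at hle
  linarith

/-- Alternating chains of low and high points persist backwards in time. -/
lemma track (N : ℕ) (hN : Even N) (U t₀ t₁ η : ℝ) (hη : 0 < η) (h10 : t₁ ≤ t₀) (a : ℕ → ℝ)
    (f : ℝ → ℝ → ℝ) (hf : Continuous (fun p : ℝ × ℝ => f p.1 p.2))
    (hgap : ∀ i, i < N → 2 * η < (-1) ^ i * (a i - a (i + 1)))
    (hend0 : ∀ t ∈ Icc t₁ t₀, a 0 ≤ f (-U) t) (hendN : ∀ t ∈ Icc t₁ t₀, a N ≤ f U t)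
    (hstep : ∀ (i : ℕ) (u t : ℝ), t ∈ Ioc t₁ t₀ → IsLocalMax (fun v => (-1) ^ i * f v t) u →
      ∀ ε : ℝ, 0 < ε → ∀ᶠ h in nhdsWithin (0 : ℝ) (Ioi 0),
        (-1) ^ i * f u t - ε * h ≤ (-1) ^ i * f u (t - h))
    (w₀ : ℕ → ℝ) (hbox : ∀ i, w₀ i ∈ Icc (-U) U) (hw0 : w₀ 0 = -U) (hwN : w₀ N = U)
    (hmono : ∀ i, i < N → w₀ i ≤ w₀ (i + 1))
    (hval : ∀ i, i ≤ N → (-1) ^ i * a i ≤ (-1) ^ i * f (w₀ i) t₀) :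
    ∃ w : ℕ → ℝ, w 0 = -U ∧ w N = U ∧ (∀ i, i < N → w i ≤ w (i + 1)) ∧
      (∀ i, i ≤ N → (-1) ^ i * a i - η ≤ (-1) ^ i * f (w i) t₁) ∧
      ∀ i, 0 < i → i < N → IsLocalMax (fun v => (-1) ^ i * f v t₁) (w i) := by
  rcases eq_or_lt_of_le h10 with heq | hlt10
  · subst heq
    obtain ⟨w, ⟨_, h1, h2, h3, h4⟩, h5⟩ := chainSet_max N U t₁ t₁ 0 a f hf
      (fun i hi => by have := hgap i hi; simp; linarith)
      ⟨w₀, hbox, hw0, hwN, hmono, fun i hi => by simpa using hval i hi⟩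
    refine ⟨w, h1, h2, h3, fun i hi => ?_, h5⟩
    have := h4 i hi
    simp at this
    linarith
  set ε := η / (t₀ - t₁) with hε
  have hd : 0 < t₀ - t₁ := by linarith
  have hεpos : 0 < ε := by positivity
  have hεη : ε * (t₀ - t₁) = η := by rw [hε]; field_simp
  have hεle : ∀ t ∈ Icc t₁ t₀, ε * (t₀ - t) ≤ η := by
    intro t ht
    rw [← hεη]
    exact mul_le_mul_of_nonneg_left (by linarith [ht.1]) hεpos.le
  have hK := chainSet_compact N U t₀ t₁ ε a f hf
  have hne : {p : (ℕ → ℝ) × ℝ | p.2 ∈ Icc t₁ t₀ ∧ p.1 ∈ chainSet N U t₀ ε a f p.2}.Nonempty :=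
    ⟨(w₀, t₀), ⟨h10, le_rfl⟩, hbox, hw0, hwN, hmono, fun i hi => by simpa using hval i hi⟩
  obtain ⟨⟨w', t⟩, ⟨htI, hw'⟩, hmin⟩ := hK.exists_isMinOn hne continuous_snd.continuousOn
  simp only at htI hw'
  obtain ⟨w, hw, hloc⟩ := chainSet_max N U t₀ t ε a f hf
    (fun i hi => by have := hgap i hi; have := hεle t htI; linarith) ⟨w', hw'⟩
  have htt : t = t₁ := by
    by_contra hne'
    have hgt : t₁ < t := lt_of_le_of_ne htI.1 (Ne.symm hne')
    have hev : ∀ᶠ h in nhdsWithin (0 : ℝ) (Ioi 0), ∀ i ∈ Finset.range N, 0 < i →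
        (-1) ^ i * f (w i) t - ε * h ≤ (-1) ^ i * f (w i) (t - h) := by
      rw [Filter.eventually_all_finset]
      intro i hi
      by_cases hi0 : 0 < i
      · exact (hstep i (w i) t ⟨hgt, htI.2⟩ (hloc i hi0 (by simpa using hi)) ε hεpos).mono
          fun h hh _ => hh
      · exact Eventually.of_forall fun h hh => absurd hh hi0
    have hev2 : ∀ᶠ h in nhdsWithin (0 : ℝ) (Ioi 0), h < t - t₁ :=
      nhdsWithin_le_nhds (Iio_mem_nhds (by linarith))
    obtain ⟨h, ⟨hh1, hh2⟩, hh3⟩ := ((hev.and hev2).and self_mem_nhdsWithin).exists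
    replace hh3 : 0 < h := hh3
    obtain ⟨k1, k2, k3, k4, k5⟩ := hw
    have hI : t - h ∈ Icc t₁ t₀ := ⟨by linarith, by linarith [htI.2]⟩
    have hnn : 0 ≤ ε * (t₀ - (t - h)) := mul_nonneg hεpos.le (by linarith [hI.2])
    have hmem : ((w, t - h) : (ℕ → ℝ) × ℝ) ∈
        {p : (ℕ → ℝ) × ℝ | p.2 ∈ Icc t₁ t₀ ∧ p.1 ∈ chainSet N U t₀ ε a f p.2} := by
      refine ⟨hI, k1, k2, k3, k4, fun i hi => ?_⟩
      simp only
      rcases Nat.eq_zero_or_pos i with h0 | hpos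
      · subst h0
        rw [k2]
        have := hend0 _ hI
        simp
        linarith
      rcases eq_or_lt_of_le hi with hiN | hiN
      · subst hiN
        rw [k3, hN.neg_one_pow]
        have := hendN _ hI
        linarith
      · have e1 := hh1 i (by simpa using hiN) hpos
        have e2 := k5 i hi
        linarith
    have : t ≤ t - h := hmin hmem
    linarith
  subst htt
  obtain ⟨k1, k2, k3, k4, k5⟩ := hw
  exact ⟨w, k2, k3, k4, fun i hi => by have := k5 i hi; rw [hεη] at this; exact this, hloc⟩

/-- second order condition at a local maximum -/
lemma locmax_second {q ζ p : ℝ → ℝ} {u d : ℝ} (hq : ∀ v, HasDerivAt q (p v * ζ v) v)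
    (hp : ∀ v, 0 < p v) (hζ : HasDerivAt ζ d u) (hmax : IsLocalMax q u) : ζ u = 0 ∧ d ≤ 0 := by
  have h0 : ζ u = 0 := by
    have := hmax.hasDerivAt_eq_zero (hq u)
    rcases mul_eq_zero.1 this with h | h
    · exact absurd h (hp u).ne'
    · exact h
  refine ⟨h0, ?_⟩
  by_contra hd
  push Not at hd
  have h1 := hasDerivAt_iff_tendsto_slope.1 hζ
  have h2 := (tendsto_order.1 h1).1 0 hd
  have h3 : ∀ᶠ v in nhdsWithin u (Ioi u), 0 < ζ v := by
    have h4 : nhdsWithin u (Ioi u) ≤ nhdsWithin u {u}ᶜ :=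
      nhdsWithin_mono u (fun v hv => ne_of_gt hv)
    filter_upwards [h4 h2, self_mem_nhdsWithin] with v hv hv2
    replace hv2 : u < v := hv2
    replace hv : 0 < slope ζ u v := hv
    rw [slope_def_field, h0, sub_zero] at hv
    have : 0 < v - u := by linarith
    rcases div_pos_iff.1 hv with h | h
    · exact h.1
    · linarith [h.2]
  have h5 : ∀ᶠ v in nhdsWithin u (Ioi u), q v ≤ q u := nhdsWithin_le_nhds hmax
  obtain ⟨δ, hδ, hsub⟩ := mem_nhdsGT_iff_exists_Ioo_subset.1 (h3.and h5)
  replace hδ : u < δ := hδ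
  set b := (u + δ) / 2
  have hub : u < b := by simp only [b]; linarith
  have hbδ : b < δ := by simp only [b]; linarith
  have hsm : StrictMonoOn q (Icc u b) := by
    refine strictMonoOn_of_deriv_pos (convex_Icc u b)
      (fun v _ => (hq v).continuousAt.continuousWithinAt) fun v hv => ?_
    rw [interior_Icc] at hv
    rw [(hq v).deriv]
    exact mul_pos (hp v) (hsub ⟨hv.1, hv.2.trans hbδ⟩).1
  have h6 := hsm ⟨le_rfl, hub.le⟩ ⟨hub.le, le_rfl⟩ hub
  have h7 := (hsub ⟨hub, hbδ⟩ : 0 < ζ b ∧ q b ≤ q u).2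
  linarith

/-- one sided first order expansion -/
lemma step_back {F : ℝ → ℝ} {t d ε : ℝ} (hF : HasDerivAt F d t) (hd : d ≤ 0) (hε : 0 < ε) :
    ∀ᶠ h in nhdsWithin (0 : ℝ) (Ioi 0), F t - ε * h ≤ F (t - h) := by
  have h1 : HasDerivAt (fun h : ℝ => F (t - h)) (-d) 0 := by
    have h2 : HasDerivAt (fun h : ℝ => t - h) (-1) 0 := by
      simpa using (hasDerivAt_id (0 : ℝ)).const_sub t
    have h3 : HasDerivAt F d (t - 0) := by simpa using hF
    exact (h3.comp (0 : ℝ) h2).congr_deriv (by ring)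
  have h2 := (tendsto_order.1 (hasDerivAt_iff_tendsto_slope.1 h1)).1 (-ε) (by linarith)
  have h4 : nhdsWithin (0 : ℝ) (Ioi 0) ≤ nhdsWithin 0 {0}ᶜ :=
    nhdsWithin_mono 0 (fun v hv => ne_of_gt hv)
  filter_upwards [h4 h2, self_mem_nhdsWithin] with h hh hpos
  replace hpos : 0 < h := hpos
  replace hh : -ε < slope (fun h : ℝ => F (t - h)) 0 h := hh
  rw [slope_def_field, sub_zero, sub_zero, lt_div_iff₀ hpos] at hh
  linarith

namespace CFlow

variable {M : ℝ} {X Y g c s k : ℝ → ℝ → ℝ}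

lemma r2_t (h : CFlow M X Y g c s k) (u t : ℝ) (ht : t < 0) :
    HasDerivAt (fun r => X u r ^ 2 + Y u r ^ 2) (2 * (k u t * wF X Y c s u t)) t := by
  have h3 := ((h.Xt u t ht).pow 2).add ((h.Yt u t ht).pow 2)
  refine h3.congr_deriv ?_
  simp only [wF]
  simp
  ring

lemma locmax (h : CFlow M X Y g c s k) (σ : ℝ) (u t b : ℝ) (hσ : σ = 1 ∨ σ = -1) (ht : t < 0)
    (hmax : IsLocalMax (fun v => σ * (X v t ^ 2 + Y v t ^ 2 + b)) u) :
    zF X Y c s u t = 0 ∧ σ * (1 + k u t * wF X Y c s u t) ≤ 0 := by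
  have h1 := locmax_second (q := fun v => σ * (X v t ^ 2 + Y v t ^ 2 + b))
    (ζ := fun v => σ * zF X Y c s v t) (p := fun v => 2 * g v t)
    (fun v => by
      have := ((h.r2_u v t ht).add_const b).const_mul σ
      refine this.congr_deriv ?_
      ring)
    (fun v => by have := h.gpos v t ht; positivity)
    ((h.zu u t ht).const_mul σ) hmax
  have hg := h.gpos u t ht
  constructor
  · rcases hσ with rfl | rfl <;> simpa using h1.1
  · have h2 : g u t * (σ * (1 + k u t * wF X Y c s u t)) ≤ 0 := by linarith [h1.2]
    by_contra hc
    push Not at hc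
    nlinarith [mul_pos hg hc]

/-- Persistence of chains for the flow. -/
lemma chain_back (h : CFlow M X Y g c s k) (N : ℕ) (hN : Even N) (hN2 : 2 ≤ N) (t₀ : ℝ) (h0 : t₀ < 0)
    (p : ℕ → ℝ) (hmono : ∀ i, 0 < i → i + 1 < N → p i ≤ p (i + 1))
    (hgap : ∀ i, 0 < i → i + 1 < N →
      0 < (-1) ^ i * ((X (p i) t₀ ^ 2 + Y (p i) t₀ ^ 2) -
        (X (p (i + 1)) t₀ ^ 2 + Y (p (i + 1)) t₀ ^ 2))) :
    ∃ C : ℝ, 0 < C ∧ ∀ t₁ ≤ t₀, ∀ R : ℝ, ∃ w : ℕ → ℝ, (∀ i, i < N → w i ≤ w (i + 1)) ∧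
      R ≤ X (w 0) t₁ ^ 2 + Y (w 0) t₁ ^ 2 ∧ R ≤ X (w N) t₁ ^ 2 + Y (w N) t₁ ^ 2 ∧
      ∀ i, 0 < i → i < N → zF X Y c s (w i) t₁ = 0 ∧
        (Odd i → X (w i) t₁ ^ 2 + Y (w i) t₁ ^ 2 ≤ -2 * t₁ + C) ∧
        (Even i → -2 * t₁ - C ≤ X (w i) t₁ ^ 2 + Y (w i) t₁ ^ 2) := by
  set r2 : ℝ → ℝ → ℝ := fun u t => X u t ^ 2 + Y u t ^ 2 with hr2
  -- a uniform gap
  obtain ⟨η, hη, hηgap⟩ : ∃ η : ℝ, 0 < η ∧ ∀ i, 0 < i → i + 1 < N →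
      2 * η < (-1) ^ i * (r2 (p i) t₀ - r2 (p (i + 1)) t₀) := by
    by_cases hNN : N = 2
    · exact ⟨1, one_pos, fun i hi hi2 => by omega⟩
    have hne : (Finset.Ioo 0 (N - 1)).Nonempty := ⟨1, by simp; omega⟩
    obtain ⟨j, hj, hjmin⟩ := Finset.exists_min_image (Finset.Ioo 0 (N - 1))
      (fun i => (-1) ^ i * (r2 (p i) t₀ - r2 (p (i + 1)) t₀)) hne
    rw [Finset.mem_Ioo] at hj
    have hjp := hgap j hj.1 (by omega)
    refine ⟨(-1) ^ j * (r2 (p j) t₀ - r2 (p (j + 1)) t₀) / 4, by simp only [hr2]; linarith, ?_⟩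
    intro i hi hi2
    have := hjmin i (by rw [Finset.mem_Ioo]; omega)
    simp only [hr2] at this ⊢
    linarith
  set A : ℝ := |r2 (p 1) t₀ + 2 * t₀| + |r2 (p (N - 1)) t₀ + 2 * t₀| + 2 * η + 1 with hA
  set a : ℕ → ℝ := fun i => if i = 0 then A else if i < N then r2 (p i) t₀ + 2 * t₀ else A with ha
  have ha0 : a 0 = A := by simp [ha]
  have haN : a N = A := by simp [ha]
  have hai : ∀ i, 0 < i → i < N → a i = r2 (p i) t₀ + 2 * t₀ := by
    intro i h1 h2; simp [ha, h1.ne', h2]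
  have hagap : ∀ i, i < N → 2 * η < (-1) ^ i * (a i - a (i + 1)) := by
    intro i hi
    rcases Nat.eq_zero_or_pos i with hz | hpos
    · subst hz
      rw [ha0, hai (0 + 1) (by omega) (by omega)]
      simp only [pow_zero, one_mul, hA, zero_add]
      have := le_abs_self (r2 (p 1) t₀ + 2 * t₀)
      have := abs_nonneg (r2 (p (N - 1)) t₀ + 2 * t₀)
      linarith
    rcases Nat.lt_or_ge (i + 1) N with hi2 | hi2
    · rw [hai i hpos hi, hai (i + 1) (by omega) hi2]
      have := hηgap i hpos hi2
      linarith
    · have hiN : i + 1 = N := by omega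
      have hodd : Odd i := by
        rcases hN with ⟨q, hq⟩
        exact ⟨q - 1, by omega⟩
      rw [hiN, haN, hai i hpos hi, hodd.neg_one_pow]
      have hi' : i = N - 1 := by omega
      have := le_abs_self (r2 (p (N - 1)) t₀ + 2 * t₀)
      have := abs_nonneg (r2 (p 1) t₀ + 2 * t₀)
      simp only [hA]
      rw [hi']
      linarith
  set C : ℝ := ∑ i ∈ Finset.range N, |a i| + η with hC
  have haC : ∀ i, i < N → |a i| + η ≤ C := by
    intro i hi
    have := Finset.single_le_sum (f := fun i => |a i|) (fun i _ => abs_nonneg _)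
      (Finset.mem_range.2 hi)
    simp only [hC]
    linarith
  refine ⟨C, lt_of_lt_of_le (by positivity) (haC 0 (by omega)), fun t₁ h10 R => ?_⟩
  obtain ⟨U', hU'⟩ := h.uproper t₁ t₀ h10 h0 (max R (A - 2 * t₁))
  set B : ℝ := ∑ i ∈ Finset.range N, |p i| with hB
  have hpB : ∀ i, i < N → |p i| ≤ B := fun i hi =>
    Finset.single_le_sum (f := fun i => |p i|) (fun i _ => abs_nonneg _) (Finset.mem_range.2 hi)
  have hB0 : 0 ≤ B := Finset.sum_nonneg fun i _ => abs_nonneg _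
  set U := max U' B with hU
  have hU0 : 0 ≤ U := hB0.trans (le_max_right _ _)
  have hpU : ∀ i, i < N → p i ∈ Icc (-U) U := fun i hi =>
    abs_le.1 ((hpB i hi).trans (le_max_right _ _))
  have hbig : ∀ u, |u| = U → ∀ t ∈ Icc t₁ t₀, max R (A - 2 * t₁) ≤ r2 u t :=
    fun u hu t ht => hU' u (by rw [hu]; exact le_max_left _ _) t ht
  have hUabs : |U| = U := abs_of_nonneg hU0
  have hUabs' : |-U| = U := by rw [abs_neg]; exact hUabs
  -- clamped function
  set f : ℝ → ℝ → ℝ := fun u t => r2 u (min t t₀) + 2 * min t t₀ with hf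
  have hfc : Continuous (fun q : ℝ × ℝ => f q.1 q.2) := by
    have hm : Continuous (fun q : ℝ × ℝ => ((q.1, min q.2 t₀) : ℝ × ℝ)) := by fun_prop
    have hlt : ∀ q : ℝ × ℝ, min q.2 t₀ < 0 := fun q => (min_le_right _ _).trans_lt h0
    have hX : Continuous (fun q : ℝ × ℝ => X q.1 (min q.2 t₀)) :=
      continuous_iff_continuousAt.2 fun q =>
        ContinuousAt.comp (f := fun q : ℝ × ℝ => ((q.1, min q.2 t₀) : ℝ × ℝ))
          (h.dX q.1 (min q.2 t₀) (hlt q)).continuousAt hm.continuousAt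
    have hY : Continuous (fun q : ℝ × ℝ => Y q.1 (min q.2 t₀)) :=
      continuous_iff_continuousAt.2 fun q =>
        ContinuousAt.comp (f := fun q : ℝ × ℝ => ((q.1, min q.2 t₀) : ℝ × ℝ))
          (h.dY q.1 (min q.2 t₀) (hlt q)).continuousAt hm.continuousAt
    exact ((hX.pow 2).add (hY.pow 2)).add
      (continuous_const.mul (continuous_snd.min continuous_const))
  have hfe : ∀ u t, t ≤ t₀ → f u t = r2 u t + 2 * t := fun u t ht => by
    simp only [hf]; rw [min_eq_left ht]
  have hσ : ∀ i : ℕ, ((-1 : ℝ) ^ i = 1 ∨ (-1 : ℝ) ^ i = -1) := fun i => neg_one_pow_eq_or ℝ i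
  have hfend : ∀ u, |u| = U → ∀ t ∈ Icc t₁ t₀, A ≤ f u t := by
    intro u hu t ht
    rw [hfe u t ht.2]
    have := (le_max_right R (A - 2 * t₁)).trans (hbig u hu t ht)
    linarith [ht.1]
  set w₀ : ℕ → ℝ := fun i => if i = 0 then -U else if i < N then p i else U with hw₀
  have hw00 : w₀ 0 = -U := by simp [hw₀]
  have hw0N : w₀ N = U := by simp [hw₀]; intro h; omega
  have hw0i : ∀ i, 0 < i → i < N → w₀ i = p i := by
    intro i h1 h2; simp [hw₀, h1.ne', h2]
  have hw0box : ∀ i, w₀ i ∈ Icc (-U) U := by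
    intro i
    simp only [hw₀]
    split_ifs with h1 h2
    · exact ⟨le_rfl, by linarith⟩
    · exact hpU i h2
    · exact ⟨by linarith, le_rfl⟩
  obtain ⟨w, k1, k2, k3, k4, k5⟩ := track N hN U t₀ t₁ η hη h10 a f hfc hagap
    (fun t ht => by rw [ha0]; exact hfend _ hUabs' t ht)
    (fun t ht => by rw [haN]; exact hfend _ hUabs t ht)
    (by
      intro i u t ht hmax ε hε
      have ht0 : t < 0 := lt_of_le_of_lt ht.2 h0
      have hmax' : IsLocalMax (fun v => (-1) ^ i * (X v t ^ 2 + Y v t ^ 2 + 2 * t)) u := by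
        refine hmax.congr ?_
        refine Eventually.of_forall fun v => ?_
        simp only
        rw [hfe v t ht.2]
      have hl := (h.locmax _ u t (2 * t) (hσ i) ht0 hmax').2
      have hder : HasDerivAt (fun r => (-1) ^ i * (X u r ^ 2 + Y u r ^ 2 + 2 * r))
          ((-1) ^ i * (2 * (k u t * wF X Y c s u t) + 2 * 1)) t :=
        ((h.r2_t u t ht0).add ((hasDerivAt_id t).const_mul 2)).const_mul _
      have hst := step_back hder (by linarith) hε
      filter_upwards [hst, self_mem_nhdsWithin] with b hb hb0
      replace hb0 : 0 < b := hb0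
      rw [hfe u t ht.2, hfe u (t - b) (by linarith [ht.2])]
      exact hb)
    w₀ hw0box hw00 hw0N
    (by
      intro i hi
      rcases Nat.eq_zero_or_pos i with hz | hpos
      · subst hz; rw [hw00]; exact (hw0box _).1
      rcases Nat.lt_or_ge (i + 1) N with hi2 | hi2
      · rw [hw0i i hpos hi, hw0i (i + 1) (by omega) hi2]; exact hmono i hpos hi2
      · have hiN : i + 1 = N := by omega
        rw [hiN, hw0N]; exact (hw0box _).2)
    (by
      intro i hi
      rcases Nat.eq_zero_or_pos i with hz | hpos
      · subst hz
        rw [ha0, hw00]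
        simpa using hfend _ hUabs' t₀ ⟨h10, le_rfl⟩
      rcases eq_or_lt_of_le hi with hiN | hiN
      · subst hiN
        rw [haN, hw0N, hN.neg_one_pow]
        simpa using hfend _ hUabs t₀ ⟨h10, le_rfl⟩
      · rw [hai i hpos hiN, hw0i i hpos hiN, hfe _ _ le_rfl])
  have h1neg : t₁ < 0 := by linarith
  refine ⟨w, k3, ?_, ?_, ?_⟩
  · rw [k1]; exact (le_max_left _ _).trans (hbig _ hUabs' t₁ ⟨le_rfl, h10⟩)
  · rw [k2]; exact (le_max_left _ _).trans (hbig _ hUabs t₁ ⟨le_rfl, h10⟩)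
  intro i hi hiN
  have hval := k4 i hiN.le
  rw [hfe _ _ h10] at hval
  have hac := haC i hiN
  refine ⟨?_, fun hodd => ?_, fun hev => ?_⟩
  · have hmax' : IsLocalMax (fun v => (-1) ^ i * (X v t₁ ^ 2 + Y v t₁ ^ 2 + 2 * t₁)) (w i) := by
      refine (k5 i hi hiN).congr ?_
      refine Eventually.of_forall fun v => ?_
      simp only
      rw [hfe v t₁ h10]
    exact (h.locmax _ (w i) t₁ (2 * t₁) (hσ i) h1neg hmax').1
  · rw [hodd.neg_one_pow] at hval
    have := le_abs_self (a i)
    simp only [hr2] at hval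
    linarith
  · rw [hev.neg_one_pow] at hval
    have := neg_abs_le (a i)
    simp only [hr2] at hval
    linarith

end CFlow

namespace CFlow

variable {M : ℝ} {X Y g c s k : ℝ → ℝ → ℝ}

lemma M_nonneg (h : CFlow M X Y g c s k) : 0 ≤ M := by
  simpa using h.mass_le (t := -1) (by norm_num) (le_refl (0 : ℝ))

/-- there are arbitrarily early times with small scale-invariant dissipation -/
lemma good_time (h : CFlow M X Y g c s k) (η S : ℝ) (hη : 0 < η) (hS : 0 < S) :
    ∃ t ≤ -S, ∀ a b, a ≤ b →
      ∫ u in a..b, rhoF X Y u t * g u t * vF X Y c s k u t ^ 2 ≤ η / (-t) := by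
  by_contra hcon
  push Not at hcon
  have hM := h.M_nonneg
  set L := (M + 2) / η with hL
  have hLpos : 0 < L := by positivity
  set t₂ := -S with ht₂
  set t₁ := -(S * Real.exp L) with ht₁
  have ht2 : t₂ < 0 := by simp only [ht₂]; linarith
  have h12 : t₁ ≤ t₂ := by
    simp only [ht₁, ht₂]
    have := Real.one_le_exp hLpos.le
    nlinarith
  have ht1 : t₁ < 0 := by linarith
  set D : ℝ → ℝ → ℝ := fun u t => rhoF X Y u t * g u t * vF X Y c s k u t ^ 2 with hD
  have hDnn : ∀ u t, t < 0 → 0 ≤ D u t := fun u t ht =>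
    mul_nonneg (h.mass_nonneg ht u) (sq_nonneg _)
  have hDc : ∀ u t, t < 0 → ContinuousAt (fun p : ℝ × ℝ => D p.1 p.2) (u, t) := fun u t ht =>
    ((h.drho u t ht).continuousAt.mul (h.dg u t ht).continuousAt).mul ((h.cv u t ht).pow 2)
  set φ : ℝ → ℝ → ℝ := fun t u => D u (min t t₂) with hφ
  have hφc : Continuous φ.uncurry := by
    refine continuous_iff_continuousAt.2 fun q => ?_
    exact ContinuousAt.comp (f := fun q : ℝ × ℝ => ((q.2, min q.1 t₂) : ℝ × ℝ))
      (hDc q.2 (min q.1 t₂) ((min_le_right _ _).trans_lt ht2)) (by fun_prop)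
  have hpar : ∀ n : ℝ, Continuous (fun t => ∫ u in (-n)..n, φ t u) := fun n =>
    intervalIntegral.continuous_parametric_intervalIntegral_of_continuous' hφc _ _
  have hDu : ∀ t, t < 0 → Continuous (fun u => D u t) := fun t ht => cont_u fun u => hDc u t ht
  -- upper bound
  obtain ⟨U, hU⟩ := h.flux_small t₁ t₂ h12 ht2 (1 / 2) (by norm_num)
  have hup : ∀ n : ℝ, 0 ≤ n → U ≤ n → ∫ t in t₁..t₂, ∫ u in (-n)..n, φ t u ≤ M + 1 := by
    intro n hn hUn
    have hsw : ∫ t in t₁..t₂, ∫ u in (-n)..n, φ t u = ∫ u in (-n)..n, ∫ t in t₁..t₂, φ t u := by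
      refine intervalIntegral_intervalIntegral_swap ?_
      have hcc : IsCompact (uIcc t₁ t₂ ×ˢ uIcc (-n) n) := isCompact_uIcc.prod isCompact_uIcc
      exact (hφc.continuousOn.integrableOn_compact hcc).mono_set
        (prod_mono uIoc_subset_uIcc uIoc_subset_uIcc)
    have heq : ∫ u in (-n)..n, ∫ t in t₁..t₂, φ t u = ∫ u in (-n)..n, ∫ t in t₁..t₂, D u t := by
      refine intervalIntegral.integral_congr fun u _ => intervalIntegral.integral_congr fun t ht => ?_
      rw [uIcc_of_le h12] at ht
      simp only [hφ]
      rw [min_eq_left ht.2]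
    rw [hsw, heq]
    have hmon := h.monotonicity (-n) n t₁ t₂ h12 ht2
    have hm1 := h.mass_le ht1 (show -n ≤ n by linarith)
    have hm2 := intervalIntegral.integral_nonneg (μ := volume) (show -n ≤ n by linarith)
      (fun u _ => h.mass_nonneg ht2 u)
    have hfa := (abs_le.1 ((h.flux_le (u := -n) h12 le_rfl ht2).trans
      (hU (-n) (by rw [abs_neg, abs_of_nonneg hn]; exact hUn)))).1
    have hfb := (abs_le.1 ((h.flux_le (u := n) h12 le_rfl ht2).trans
      (hU n (by rw [abs_of_nonneg hn]; exact hUn)))).2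
    simp only [hD]
    linarith
  have hT : Tendsto (fun n : ℕ => ∫ t in t₁..t₂, min (∫ u in (-(n : ℝ))..n, φ t u) (η / (-t))) atTop
      (nhds (∫ t in t₁..t₂, η / (-t))) := by
    refine intervalIntegral.tendsto_integral_filter_of_dominated_convergence
      (fun t => η / (-t₂)) ?_ ?_ ?_ ?_
    · refine Eventually.of_forall fun n => ?_
      have hm : Measurable (fun t : ℝ => min (∫ u in (-(n : ℝ))..n, φ t u) (η / (-t))) :=
        (hpar n).measurable.min (by fun_prop)
      exact hm.aestronglyMeasurable
    · refine Eventually.of_forall fun n => Eventually.of_forall fun t ht => ?_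
      rw [uIoc_of_le h12] at ht
      have ht0 : t < 0 := lt_of_le_of_lt ht.2 ht2
      have h1 : 0 ≤ ∫ u in (-(n : ℝ))..n, φ t u :=
        intervalIntegral.integral_nonneg (by linarith [Nat.cast_nonneg (α := ℝ) n]) fun u _ =>
          hDnn u _ ((min_le_right _ _).trans_lt ht2)
      have h2 : 0 ≤ η / (-t) := div_nonneg hη.le (by linarith)
      rw [Real.norm_eq_abs, abs_of_nonneg (le_min h1 h2)]
      refine (min_le_right _ _).trans ?_
      exact div_le_div_of_nonneg_left hη.le (by linarith) (by linarith [ht.2])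
    · simp
    · refine Eventually.of_forall fun t ht => ?_
      rw [uIoc_of_le h12] at ht
      have ht0 : t < 0 := lt_of_le_of_lt ht.2 ht2
      obtain ⟨a, b, hab, hlt⟩ := hcon t ht.2
      refine tendsto_const_nhds.congr' ?_
      filter_upwards [eventually_ge_atTop ⌈max (-a) b⌉₊] with n hn
      have hn' : max (-a) b ≤ n := Nat.ceil_le.1 hn
      have ha : -(n : ℝ) ≤ a := by linarith [le_max_left (-a) b]
      have hb : b ≤ n := (le_max_right (-a) b).trans hn'
      have hmin : min t t₂ = t := min_eq_left ht.2
      have h1 : ∫ u in a..b, D u t ≤ ∫ u in (-(n : ℝ))..n, φ t u := by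
        simp only [hφ, hmin]
        exact intervalIntegral.integral_mono_interval ha hab hb
          (Eventually.of_forall fun u => hDnn u t ht0) ((hDu t ht0).intervalIntegrable _ _)
      exact (min_eq_right (hlt.le.trans h1)).symm
  have hval : ∫ t in t₁..t₂, η / (-t) = M + 2 := by
    have e1 : ∀ t : ℝ, η / (-t) = (-η) * t⁻¹ := fun t => by
      rw [div_neg, div_eq_mul_inv]; ring
    simp only [e1]
    rw [intervalIntegral.integral_const_mul, integral_inv_of_neg ht1 ht2]
    have e2 : t₂ / t₁ = Real.exp (-L) := by
      simp only [ht₁, ht₂]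
      rw [Real.exp_neg]
      have := Real.exp_pos L
      field_simp
    rw [e2, Real.log_exp, hL]
    field_simp
  rw [hval] at hT
  have hle : M + 2 ≤ M + 1 := by
    refine le_of_tendsto hT ?_
    filter_upwards [eventually_ge_atTop ⌈U⌉₊] with n hn
    refine le_trans ?_ (hup n (Nat.cast_nonneg n) (Nat.ceil_le.1 hn))
    refine intervalIntegral.integral_mono_on h12 ?_ ((hpar n).intervalIntegrable _ _)
      fun t _ => min_le_left _ _
    refine ContinuousOn.intervalIntegrable ?_
    rw [uIcc_of_le h12]
    have hq : ContinuousOn (fun t : ℝ => η / (-t)) (Icc t₁ t₂) := by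
      refine continuousOn_const.div continuousOn_id.neg fun t ht => ?_
      have : t < 0 := lt_of_le_of_lt ht.2 ht2
      simpa using this.ne
    exact ContinuousOn.inf (hpar n).continuousOn hq
  linarith

/-- smallness of the normal part at good times -/
lemma Q_bound (h : CFlow M X Y g c s k) (t β : ℝ) (ht : t < 0) (hβ : 0 < β)
    (hgood : ∀ a b, a ≤ b →
      ∫ u in a..b, rhoF X Y u t * g u t * vF X Y c s k u t ^ 2 ≤ β ^ 2 / (-t)) (u : ℝ) :
    |wF X Y c s u t| * Real.exp (-(X u t ^ 2 + Y u t ^ 2) / (4 * (-t))) ≤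
      (16 * M + 1) / 2 * β * Real.sqrt (-t) := by
  have hτ : 0 < -t := by linarith
  set τ := -t with hτd
  have hS := Real.sqrt_pos.2 hτ
  have hS2 := Real.sq_sqrt hτ.le
  set S := Real.sqrt τ with hSd
  have hM := h.M_nonneg
  set E : ℝ → ℝ := fun u => Real.exp (-(X u t ^ 2 + Y u t ^ 2) / (4 * τ)) with hE
  set E8 : ℝ → ℝ := fun u => Real.exp (-(X u t ^ 2 + Y u t ^ 2) / (4 * (2 * τ))) with hE8
  have hEE : ∀ u, E u = E8 u * E8 u := fun u => by
    simp only [hE, hE8]; rw [← Real.exp_add]; congr 1; field_simp; ring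
  have hEpos : ∀ u, 0 < E u := fun u => Real.exp_pos _
  have hE8pos : ∀ u, 0 < E8 u := fun u => Real.exp_pos _
  have hE8le : ∀ u, 1 + (X u t ^ 2 + Y u t ^ 2) / (8 * τ) ≤ (E8 u)⁻¹ := fun u => by
    simp only [hE8]
    rw [← Real.exp_neg]
    have := Real.add_one_le_exp (-(-(X u t ^ 2 + Y u t ^ 2) / (4 * (2 * τ))))
    have e : -(-(X u t ^ 2 + Y u t ^ 2) / (4 * (2 * τ))) = (X u t ^ 2 + Y u t ^ 2) / (8 * τ) := by
      field_simp; ring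
    rw [e] at this ⊢
    linarith
  set z : ℝ → ℝ := fun u => zF X Y c s u t with hz
  set w : ℝ → ℝ := fun u => wF X Y c s u t with hw
  set v : ℝ → ℝ := fun u => vF X Y c s k u t with hv
  have hzw : ∀ u, z u ^ 2 + w u ^ 2 = X u t ^ 2 + Y u t ^ 2 := fun u => h.zw u t ht
  have hEcont : Continuous E := by
    have := h.Xcont ht
    have := h.Ycont ht
    simp only [hE]; fun_prop
  have hE8cont : Continuous E8 := by
    have := h.Xcont ht
    have := h.Ycont ht
    simp only [hE8]; fun_prop
  have hzc : Continuous z := h.zcont ht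
  have hvc : Continuous v := h.vcont ht
  have hgc := h.gcont ht
  have hQder : ∀ u, HasDerivAt (fun u => w u * E u) (-(g u t * E u * z u * v u)) u := by
    intro u
    have h1 := (h.r2_u u t ht).neg.div_const (4 * τ)
    have h2 := (h.wu u t ht).mul h1.exp
    refine h2.congr_deriv ?_
    simp only [hz, hv, vF, hE]
    have : t ≠ 0 := ht.ne
    simp only [hτd]
    field_simp
    simp only [Pi.neg_apply]
    ring_nf
  -- zE bound
  have hz2 : ∀ u, z u ^ 2 * E u ≤ 8 * τ * E8 u := by
    intro u
    rw [hEE u]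
    have h1 := hE8le u
    have h3 : z u ^ 2 ≤ 8 * τ * (E8 u)⁻¹ := by
      have h4 : z u ^ 2 ≤ X u t ^ 2 + Y u t ^ 2 := by nlinarith [hzw u, sq_nonneg (w u)]
      have h5 : X u t ^ 2 + Y u t ^ 2 = 8 * τ * ((X u t ^ 2 + Y u t ^ 2) / (8 * τ)) := by
        field_simp
      have h6 : 8 * τ * (1 + (X u t ^ 2 + Y u t ^ 2) / (8 * τ)) ≤ 8 * τ * (E8 u)⁻¹ :=
        mul_le_mul_of_nonneg_left h1 (by positivity)
      nlinarith
    calc z u ^ 2 * (E8 u * E8 u) ≤ 8 * τ * (E8 u)⁻¹ * (E8 u * E8 u) :=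
          mul_le_mul_of_nonneg_right h3 (mul_pos (hE8pos u) (hE8pos u)).le
      _ = 8 * τ * E8 u := by have := (hE8pos u).ne'; field_simp
  have hdiff : ∀ a b, a ≤ b → |w b * E b - w a * E a| ≤ (16 * M + 1) / 2 * β * S := by
    intro a b hab
    rw [← intervalIntegral.integral_eq_sub_of_hasDerivAt (fun u _ => hQder u)
      (Continuous.intervalIntegrable (by fun_prop) _ _)]
    refine (intervalIntegral.abs_integral_le_integral_abs hab).trans ?_
    set α := β / τ with hα
    have hαpos : 0 < α := by positivity
    have hpt : ∀ u, |(-(g u t * E u * z u * v u))| ≤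
        (α / 2 * (8 * τ)) * (E8 u * g u t) + (S / (2 * α)) * (rhoF X Y u t * g u t * v u ^ 2) := by
      intro u
      have hg := h.gpos u t ht
      have hr : rhoF X Y u t = E u / S := rfl
      rw [hr, abs_neg, abs_mul, abs_mul, abs_of_pos (mul_pos hg (hEpos u))]
      have h1 : |z u| * |v u| ≤ α / 2 * z u ^ 2 + v u ^ 2 / (2 * α) := by
        have h2 : α / 2 * z u ^ 2 + v u ^ 2 / (2 * α) - |z u| * |v u| = (α * |z u| - |v u|) ^ 2 / (2 * α) := by
          rw [← sq_abs (z u), ← sq_abs (v u)]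
          field_simp; ring
        have : 0 ≤ (α * |z u| - |v u|) ^ 2 / (2 * α) := by positivity
        linarith
      calc g u t * E u * |z u| * |v u| = g u t * E u * (|z u| * |v u|) := by ring
        _ ≤ g u t * E u * (α / 2 * z u ^ 2 + v u ^ 2 / (2 * α)) :=
            mul_le_mul_of_nonneg_left h1 (mul_pos hg (hEpos u)).le
        _ = α / 2 * g u t * (z u ^ 2 * E u) + g u t * E u * (v u ^ 2 / (2 * α)) := by ring
        _ ≤ α / 2 * g u t * (8 * τ * E8 u) + g u t * E u * (v u ^ 2 / (2 * α)) := by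
            have := mul_le_mul_of_nonneg_left (hz2 u) (by positivity : 0 ≤ α / 2 * g u t)
            linarith
        _ = _ := by field_simp
    have hi1 : IntervalIntegrable (fun u => (α / 2 * (8 * τ)) * (E8 u * g u t)) volume a b :=
      Continuous.intervalIntegrable (by fun_prop) _ _
    have hi2 : IntervalIntegrable (fun u => (S / (2 * α)) * (rhoF X Y u t * g u t * v u ^ 2)) volume a b := by
      have := h.mass_cont ht
      exact Continuous.intervalIntegrable (by fun_prop) _ _
    refine (intervalIntegral.integral_mono_on hab (Continuous.intervalIntegrable (by fun_prop) _ _)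
      (hi1.add hi2) (fun u _ => hpt u)).trans ?_
    rw [intervalIntegral.integral_add hi1 hi2, intervalIntegral.integral_const_mul,
      intervalIntegral.integral_const_mul]
    have he := h.ent t ht (2 * τ) (by positivity) a b hab
    have hgd := hgood a b hab
    have hs2 : Real.sqrt (2 * τ) ≤ 2 * S := by
      rw [Real.sqrt_le_left (by positivity)]
      rw [mul_pow, hS2]; linarith
    have he' : ∫ u in a..b, E8 u * g u t ≤ M * (2 * S) := he.trans (mul_le_mul_of_nonneg_left hs2 hM)
    have f1 : (α / 2 * (8 * τ)) * (∫ u in a..b, E8 u * g u t) ≤ (α / 2 * (8 * τ)) * (M * (2 * S)) :=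
      mul_le_mul_of_nonneg_left he' (by positivity)
    have f2 : (S / (2 * α)) * (∫ u in a..b, rhoF X Y u t * g u t * v u ^ 2) ≤
        (S / (2 * α)) * (β ^ 2 / τ) := mul_le_mul_of_nonneg_left hgd (by positivity)
    have f3 : (α / 2 * (8 * τ)) * (M * (2 * S)) = 8 * M * β * S := by
      rw [hα]; field_simp
    have f4 : (S / (2 * α)) * (β ^ 2 / τ) = β * S / 2 := by
      rw [hα]; field_simp
    rw [f3] at f1
    rw [f4] at f2
    linarith
  -- decay at infinity
  refine le_of_forall_pos_le_add fun ε hε => ?_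
  have hwE : ∀ u, |w u * E u| ≤ 2 * S * E8 u := by
    intro u
    rw [hEE u, abs_mul, abs_of_pos (mul_pos (hE8pos u) (hE8pos u))]
    have h1 := hE8le u
    have h3 : |w u| ≤ 2 * S * (E8 u)⁻¹ := by
      have h4 : w u ^ 2 ≤ X u t ^ 2 + Y u t ^ 2 := by nlinarith [hzw u, sq_nonneg (z u)]
      have h7 : |w u| ≤ 2 * S * (1 + (X u t ^ 2 + Y u t ^ 2) / (8 * τ)) := by
        have h8 : |w u| * (4 * S) ≤ 8 * S ^ 2 + (X u t ^ 2 + Y u t ^ 2) := by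
          nlinarith [sq_nonneg (|w u| - 2 * S), sq_abs (w u)]
        have : 2 * S * (1 + (X u t ^ 2 + Y u t ^ 2) / (8 * τ)) =
            (8 * S ^ 2 + (X u t ^ 2 + Y u t ^ 2)) / (4 * S) := by
          rw [← hS2]; field_simp; ring
        rw [this, le_div_iff₀ (by positivity)]
        exact h8
      exact h7.trans (mul_le_mul_of_nonneg_left h1 (by positivity))
    calc |w u| * (E8 u * E8 u) ≤ 2 * S * (E8 u)⁻¹ * (E8 u * E8 u) :=
          mul_le_mul_of_nonneg_right h3 (mul_pos (hE8pos u) (hE8pos u)).le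
      _ = 2 * S * E8 u := by have := (hE8pos u).ne'; field_simp
  obtain ⟨U, hU⟩ := h.proper t ht (8 * τ * (2 * S / ε))
  set b := max u |U| with hb
  have hub : u ≤ b := le_max_left _ _
  have hUb : U ≤ |b| := (le_abs_self U).trans ((le_max_right u |U|).trans (le_abs_self b))
  have hbs : 2 * S * E8 b ≤ ε := by
    have h1 := hE8le b
    have h2 := hU b hUb
    have h3 : 2 * S / ε ≤ (X b t ^ 2 + Y b t ^ 2) / (8 * τ) := by
      rw [le_div_iff₀ (by positivity)]; linarith
    have h4 : 2 * S / ε ≤ (E8 b)⁻¹ := by linarith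
    have h5 := mul_le_mul_of_nonneg_right h4 (mul_pos hε (hE8pos b)).le
    have h6 : 2 * S / ε * (ε * E8 b) = 2 * S * E8 b := by field_simp
    have h7 : (E8 b)⁻¹ * (ε * E8 b) = ε := by have := (hE8pos b).ne'; field_simp
    linarith
  have hd := hdiff u b hub
  have h9 := hwE b
  have h10 : |wF X Y c s u t| * Real.exp (-(X u t ^ 2 + Y u t ^ 2) / (4 * τ)) = |w u * E u| := by
    rw [abs_mul, abs_of_pos (hEpos u)]
  rw [h10]
  have h11 : |w u * E u| ≤ |w b * E b| + |w b * E b - w u * E u| := by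
    have := abs_sub_abs_le_abs_sub (w u * E u) (w b * E b)
    rw [abs_sub_comm] at this
    linarith
  linarith

end CFlow

lemma PhiF_tendsto : Tendsto (PhiF 1) atTop (nhds (Real.sqrt π)) := by
  have e : (fun z : ℝ => Real.exp (-z ^ 2 / (4 * 1))) = fun z : ℝ => Real.exp (-(1 / 4) * z ^ 2) := by
    ext z; congr 1; ring
  have h1 : IntegrableOn (fun z : ℝ => Real.exp (-z ^ 2 / (4 * 1))) (Ioi 0) := by
    rw [e]
    exact (integrable_exp_neg_mul_sq (by norm_num : (0 : ℝ) < 1 / 4)).integrableOn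
  have h2 := intervalIntegral_tendsto_integral_Ioi (0 : ℝ) h1 tendsto_id
  have h3 : ∫ z in Ioi (0 : ℝ), Real.exp (-z ^ 2 / (4 * 1)) = Real.sqrt π := by
    rw [e, integral_gaussian_Ioi]
    rw [show π / (1 / 4) = 2 ^ 2 * π by ring, Real.sqrt_mul (by norm_num), Real.sqrt_sq (by norm_num)]
    ring
  rw [h3] at h2
  exact h2

lemma PhiF_zero (l : ℝ) : PhiF l 0 = 0 := by simp [PhiF]

lemma PhiF_scale (τ y : ℝ) (hτ : 0 < τ) :
    PhiF τ (Real.sqrt τ * y) = Real.sqrt τ * PhiF 1 y := by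
  have hS := Real.sqrt_pos.2 hτ
  have hS2 := Real.sq_sqrt hτ.le
  unfold PhiF
  have h1 := intervalIntegral.mul_integral_comp_mul_left (a := 0) (b := y)
    (f := fun z : ℝ => Real.exp (-z ^ 2 / (4 * τ))) (Real.sqrt τ)
  rw [mul_zero] at h1
  rw [← h1]
  congr 1
  refine intervalIntegral.integral_congr fun z _ => ?_
  congr 1
  rw [mul_pow, hS2]
  field_simp

namespace CFlow

variable {M : ℝ} {X Y g c s k : ℝ → ℝ → ℝ}

/-- Long alternating chains violate the entropy bound. -/
lemma no_chain (h : CFlow M X Y g c s k) (N : ℕ) (hN : Even N) (hN2 : 2 ≤ N)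
    (hMN : M < N * Real.sqrt π) (t₀ : ℝ) (h0 : t₀ < 0)
    (p : ℕ → ℝ) (hmono : ∀ i, 0 < i → i + 1 < N → p i ≤ p (i + 1))
    (hgap : ∀ i, 0 < i → i + 1 < N →
      0 < (-1) ^ i * ((X (p i) t₀ ^ 2 + Y (p i) t₀ ^ 2) -
        (X (p (i + 1)) t₀ ^ 2 + Y (p (i + 1)) t₀ ^ 2))) : False := by
  have hM := h.M_nonneg
  have hNpos : (0 : ℝ) < N := by exact_mod_cast (by omega : 0 < N)
  -- choose the constants
  obtain ⟨K, hK2, hK⟩ : ∃ K : ℝ, 2 ≤ K ∧ M < N * PhiF 1 K := by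
    have h1 : Tendsto (fun y => N * PhiF 1 y) atTop (nhds (N * Real.sqrt π)) :=
      PhiF_tendsto.const_mul _
    have h2 := (tendsto_order.1 h1).1 M hMN
    obtain ⟨K, hK1, hK2⟩ := (h2.and (eventually_ge_atTop (2 : ℝ))).exists
    exact ⟨K, hK2, hK1⟩
  obtain ⟨δ, hδ0, hδ1, hδ⟩ : ∃ δ : ℝ, 0 < δ ∧ δ < 1 ∧ M < N * (PhiF 1 K - PhiF 1 δ) := by
    have h1 : Tendsto (fun y => N * (PhiF 1 K - PhiF 1 y)) (nhdsWithin 0 (Ioi 0))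
        (nhds (N * (PhiF 1 K - PhiF 1 0))) := by
      have : Continuous (fun y => N * (PhiF 1 K - PhiF 1 y)) := by
        have := PhiF_continuous 1
        fun_prop
      exact (this.tendsto 0).mono_left nhdsWithin_le_nhds
    rw [PhiF_zero, sub_zero] at h1
    have h2 := (tendsto_order.1 h1).1 M hK
    have h3 : ∀ᶠ y in nhdsWithin (0 : ℝ) (Ioi 0), y < 1 :=
      nhdsWithin_le_nhds (Iio_mem_nhds one_pos)
    obtain ⟨δ, ⟨hδ1, hδ2⟩, hδ3⟩ := ((h2.and h3).and self_mem_nhdsWithin).exists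
    exact ⟨δ, hδ3, hδ2, hδ1⟩
  set C := (16 * M + 1) / 2 with hC
  have hCpos : 0 < C := by positivity
  set β := δ * Real.exp (-K ^ 2 / 4) / (2 * C) with hβ
  have hβpos : 0 < β := by have := Real.exp_pos (-K ^ 2 / 4); positivity
  have hCβ : C * β < δ * Real.exp (-K ^ 2 / 4) := by
    have : C * β = δ * Real.exp (-K ^ 2 / 4) / 2 := by rw [hβ]; field_simp
    rw [this]
    have : 0 < δ * Real.exp (-K ^ 2 / 4) := mul_pos hδ0 (Real.exp_pos _)
    linarith
  obtain ⟨C₀, hC₀, hback⟩ := h.chain_back N hN hN2 t₀ h0 p hmono hgap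
  obtain ⟨t, htS, hgood⟩ := h.good_time (β ^ 2) (max C₀ (-t₀)) (by positivity)
    (lt_of_lt_of_le hC₀ (le_max_left _ _))
  have htC : C₀ ≤ -t := by linarith [le_max_left C₀ (-t₀)]
  have htt : t ≤ t₀ := by linarith [le_max_right C₀ (-t₀)]
  have ht : t < 0 := by linarith
  have hτ : 0 < -t := by linarith
  set τ := -t with hτd
  have hS := Real.sqrt_pos.2 hτ
  have hS2 := Real.sq_sqrt hτ.le
  set S := Real.sqrt τ with hSd
  obtain ⟨w, hwm, hw0, hwN, hwi⟩ := hback t htt (K ^ 2 * τ)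
  set r : ℕ → ℝ := fun i => Real.sqrt (X (w i) t ^ 2 + Y (w i) t ^ 2) with hr
  have hr0 : ∀ i, 0 ≤ r i := fun i => Real.sqrt_nonneg _
  have hr2 : ∀ i, r i ^ 2 = X (w i) t ^ 2 + Y (w i) t ^ 2 := fun i => Real.sq_sqrt (by positivity)
  have hbigK : ∀ i, K ^ 2 * τ ≤ X (w i) t ^ 2 + Y (w i) t ^ 2 → S * K ≤ r i := by
    intro i hi
    refine Real.le_sqrt_of_sq_le ?_
    rw [mul_pow, hS2]; linarith
  -- gap at critical points
  have hcrit : ∀ i, zF X Y c s (w i) t = 0 → r i < S * δ ∨ S * K < r i := by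
    intro i hz
    by_contra hcon
    push Not at hcon
    obtain ⟨h1, h2⟩ := hcon
    have hQ := h.Q_bound t β ht hβpos hgood (w i)
    have hzw := h.zw (w i) t ht
    rw [hz] at hzw
    have hw' : |wF X Y c s (w i) t| = r i := by
      rw [← abs_of_nonneg (hr0 i)]
      refine (sq_eq_sq_iff_abs_eq_abs _ _).1 ?_
      rw [hr2 i, ← hzw]; ring
    rw [hw', ← hr2 i] at hQ
    have h3 : Real.exp (-K ^ 2 / 4) ≤ Real.exp (-r i ^ 2 / (4 * -t)) := by
      refine Real.exp_le_exp.2 ?_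
      rw [neg_div, neg_div, neg_le_neg_iff, div_le_div_iff₀ (by positivity) (by norm_num)]
      have : r i ^ 2 ≤ (S * K) ^ 2 := pow_le_pow_left₀ (hr0 i) h2 2
      rw [mul_pow, hS2] at this
      nlinarith
    have h4 : S * δ * Real.exp (-K ^ 2 / 4) ≤ r i * Real.exp (-r i ^ 2 / (4 * -t)) :=
      mul_le_mul h1 h3 (Real.exp_pos _).le (hr0 i)
    have h5 : S * (C * β) < S * (δ * Real.exp (-K ^ 2 / 4)) := mul_lt_mul_of_pos_left hCβ hS
    have h6 : (16 * M + 1) / 2 * β * √(-t) = S * (C * β) := by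
      simp only [hC, hSd, hτd]; ring
    linarith
  have hlow : ∀ i, i ≤ N → Odd i → r i ≤ S * δ := by
    intro i hi hodd
    have hiN : i < N := lt_of_le_of_ne hi fun he => by
      subst he; exact (Nat.not_even_iff_odd.2 hodd) hN
    have hi0 : 0 < i := hodd.pos
    obtain ⟨hz, ho, -⟩ := hwi i hi0 hiN
    rcases hcrit i hz with h1 | h1
    · exact h1.le
    · exfalso
      have h2 := ho hodd
      rw [← hr2 i] at h2
      have h3 : (S * K) ^ 2 < r i ^ 2 := pow_lt_pow_left₀ h1 (by positivity) (by norm_num)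
      rw [mul_pow, hS2] at h3
      have : τ * 2 ^ 2 ≤ τ * K ^ 2 :=
        mul_le_mul_of_nonneg_left (pow_le_pow_left₀ (by norm_num) hK2 2) hτ.le
      linarith
  have hhigh : ∀ i, i ≤ N → Even i → S * K ≤ r i := by
    intro i hi hev
    rcases Nat.eq_zero_or_pos i with hz | hi0
    · subst hz; exact hbigK 0 hw0
    rcases eq_or_lt_of_le hi with hiN | hiN
    · subst hiN; exact hbigK _ hwN
    obtain ⟨hz, -, ho⟩ := hwi i hi0 hiN
    rcases hcrit i hz with h1 | h1
    · exfalso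
      have h2 := ho hev
      rw [← hr2 i] at h2
      have h3 : r i ^ 2 < (S * δ) ^ 2 := pow_lt_pow_left₀ h1 (hr0 i) (by norm_num)
      rw [mul_pow, hS2] at h3
      have : δ ^ 2 < 1 := by nlinarith
      have : τ * δ ^ 2 < τ * 1 := mul_lt_mul_of_pos_left this hτ
      linarith
    · exact h1.le
  -- sum
  have hterm : ∀ i ∈ Finset.range N, S * (PhiF 1 K - PhiF 1 δ) ≤
      ∫ u in (w i)..(w (i + 1)), Real.exp (-(X u t ^ 2 + Y u t ^ 2) / (4 * τ)) * g u t := by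
    intro i hi
    rw [Finset.mem_range] at hi
    refine le_trans ?_ (h.lemL t ht τ hτ (w i) (w (i + 1)) (hwm i hi))
    have hsc : ∀ x y, S * K ≤ x → y ≤ S * δ → S * (PhiF 1 K - PhiF 1 δ) ≤ PhiF τ x - PhiF τ y := by
      intro x y hx hy
      rw [mul_sub, ← PhiF_scale τ K hτ, ← PhiF_scale τ δ hτ]
      have := PhiF_mono τ hx
      have := PhiF_mono τ hy
      linarith
    rcases Nat.even_or_odd i with hev | hodd
    · rw [abs_sub_comm]
      exact (hsc _ _ (hhigh i hi.le hev) (hlow (i + 1) hi hev.add_one)).trans (le_abs_self _)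
    · exact (hsc _ _ (hhigh (i + 1) hi hodd.add_one) (hlow i hi.le hodd)).trans (le_abs_self _)
  have hsum := Finset.sum_le_sum hterm
  have hcont : Continuous (fun u => Real.exp (-(X u t ^ 2 + Y u t ^ 2) / (4 * τ)) * g u t) := by
    have := h.Xcont ht
    have := h.Ycont ht
    have := h.gcont ht
    fun_prop
  rw [intervalIntegral.sum_integral_adjacent_intervals
    (fun i _ => hcont.intervalIntegrable _ _)] at hsum
  have hw0N : w 0 ≤ w N := by
    have : ∀ j, j ≤ N → w 0 ≤ w j := by
      intro j
      induction j with
      | zero => intro _; exact le_rfl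
      | succ j ih => intro hj; exact (ih (by omega)).trans (hwm j (by omega))
    exact this N le_rfl
  have hent := h.ent t ht τ hτ (w 0) (w N) hw0N
  simp only [Finset.sum_const, Finset.card_range, nsmul_eq_mul] at hsum
  have : S * M < S * (N * (PhiF 1 K - PhiF 1 δ)) := mul_lt_mul_of_pos_left hδ hS
  have hh : M * √τ = S * M := by simp only [hSd]; ring
  linarith

end CFlow

lemma exists_gt_right {F : ℝ → ℝ} {a b d : ℝ} (hd : HasDerivAt F d a) (h0 : 0 < d) (hab : a < b) :
    ∃ x ∈ Ioo a b, F a < F x := by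
  have h1 := (hasDerivWithinAt_iff_tendsto_slope' (s := Ioi a) (by simp)).1 hd.hasDerivWithinAt
  have h2 := h1.eventually (lt_mem_nhds h0)
  obtain ⟨x, hx, hx2⟩ := (h2.and (Ioo_mem_nhdsGT hab)).exists
  refine ⟨x, hx2, ?_⟩
  rw [slope_def_field] at hx
  have h3 : 0 < x - a := by linarith [hx2.1]
  have := (div_pos_iff_of_pos_right h3).1 hx
  linarith

lemma exists_gt_left {F : ℝ → ℝ} {a b d : ℝ} (hd : HasDerivAt F d b) (h0 : d < 0) (hab : a < b) :
    ∃ x ∈ Ioo a b, F b < F x := by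
  have h1 : HasDerivAt (fun x => F (-x)) (-d) (-b) := by
    have h2 : HasDerivAt F d (-(-b)) := by simpa using hd
    exact (h2.comp (-b) (hasDerivAt_neg (-b))).congr_deriv (by ring)
  obtain ⟨x, hx, hx2⟩ := exists_gt_right h1 (by linarith) (neg_lt_neg hab)
  refine ⟨-x, ⟨by linarith [hx.2], by linarith [hx.1]⟩, by simpa using hx2⟩

namespace CFlow

variable {M : ℝ} {X Y g c s k : ℝ → ℝ → ℝ}

/-- No long alternation of the sign of the tangential component of the position. -/
lemma no_alt (m : ℕ) (hm : 0 < m) (h : CFlow (2 * m * Real.sqrt π) X Y g c s k)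
    (t₀ : ℝ) (h0 : t₀ < 0) (σ : ℕ → ℝ)
    (hσ : ∀ j, j + 1 < 2 * m → σ j < σ (j + 1))
    (hz : ∀ j, j < 2 * m → 0 < (-1) ^ j * zF X Y c s (σ j) t₀) : False := by
  set f : ℝ → ℝ := fun v => X v t₀ ^ 2 + Y v t₀ ^ 2 with hf
  have hfd : ∀ u, HasDerivAt f (2 * g u t₀ * zF X Y c s u t₀) u := fun u => h.r2_u u t₀ h0
  have hfc : Continuous f := continuous_iff_continuousAt.2 fun u => (hfd u).continuousAt
  have key : ∀ j, ∃ q, j + 1 < 2 * m → q ∈ Icc (σ j) (σ (j + 1)) ∧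
      (-1) ^ j * f (σ j) < (-1) ^ j * f q ∧ (-1) ^ j * f (σ (j + 1)) < (-1) ^ j * f q := by
    intro j
    by_cases hj : j + 1 < 2 * m
    · have hlt := hσ j hj
      obtain ⟨q, hq, hmax⟩ := isCompact_Icc.exists_isMaxOn (nonempty_Icc.2 hlt.le)
        ((continuous_const.mul hfc : Continuous fun x => (-1 : ℝ) ^ j * f x).continuousOn)
      have hd : ∀ u, HasDerivAt (fun x => (-1 : ℝ) ^ j * f x)
        ((-1) ^ j * (2 * g u t₀ * zF X Y c s u t₀)) u := fun u => (hfd u).const_mul _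
      refine ⟨q, fun _ => ⟨hq, ?_, ?_⟩⟩
      · have hp : 0 < (-1 : ℝ) ^ j * (2 * g (σ j) t₀ * zF X Y c s (σ j) t₀) := by
          have := mul_pos (h.gpos (σ j) t₀ h0) (hz j (by omega))
          nlinarith
        obtain ⟨x, hx, hx2⟩ := exists_gt_right (hd _) hp hlt
        exact hx2.trans_le (hmax (Ioo_subset_Icc_self hx))
      · have hp : (-1 : ℝ) ^ j * (2 * g (σ (j+1)) t₀ * zF X Y c s (σ (j+1)) t₀) < 0 := by
          have := mul_pos (h.gpos (σ (j+1)) t₀ h0) (hz (j+1) (by omega))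
          rw [pow_succ] at this
          nlinarith
        obtain ⟨x, hx, hx2⟩ := exists_gt_left (hd _) hp hlt
        exact hx2.trans_le (hmax (Ioo_subset_Icc_self hx))
    · exact ⟨0, fun h => absurd h hj⟩
  choose q hq using key
  have hN : ((2 * m + 2 : ℕ) : ℝ) = 2 * m + 2 := by push_cast; ring
  refine h.no_chain (2 * m + 2) ⟨m + 1, by ring⟩ (by omega) ?_ t₀ h0
    (fun i => if i ≤ 1 then σ 0 else if i ≤ 2 * m then q (i - 2) else σ (2 * m - 1)) ?_ ?_
  · rw [hN]
    have : 0 < Real.sqrt π := Real.sqrt_pos.2 Real.pi_pos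
    nlinarith
  · intro i hi hi2
    obtain rfl | hi1 := eq_or_ne i 1
    · have := hq 0 (by omega)
      simp only [le_refl, if_true]
      rw [if_neg (by omega), if_pos (by omega)]
      exact this.1.1
    · obtain ⟨j, rfl⟩ : ∃ j, i = j + 2 := ⟨i - 2, by omega⟩
      have h1 := hq j (by omega)
      rw [if_neg (by omega), if_pos (by omega), if_neg (by omega)]
      by_cases hlast : j + 2 + 1 ≤ 2 * m
      · rw [if_pos hlast]
        have h2 := hq (j + 1) (by omega)
        exact h1.1.2.trans h2.1.1
      · rw [if_neg hlast]
        have : 2 * m - 1 = j + 1 := by omega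
        rw [this]
        exact h1.1.2
  · intro i hi hi2
    obtain rfl | hi1 := eq_or_ne i 1
    · have h1 := (hq 0 (by omega)).2.1
      simp only [le_refl, if_true]
      rw [if_neg (by omega), if_pos (by omega)]
      simp [hf] at h1 ⊢
      linarith
    · obtain ⟨j, rfl⟩ : ∃ j, i = j + 2 := ⟨i - 2, by omega⟩
      have h1 := hq j (by omega)
      rw [if_neg (by omega), if_pos (by omega), if_neg (by omega)]
      have e1 : j + 2 - 2 = j := by omega
      have e2 : j + 2 + 1 - 2 = j + 1 := by omega
      have e3 : (-1 : ℝ) ^ (j + 2) = (-1) ^ j := by rw [pow_add]; norm_num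
      rw [e1, e2, e3]
      by_cases hlast : j + 2 + 1 ≤ 2 * m
      · rw [if_pos hlast]
        have h2 := (hq (j + 1) (by omega)).2.1
        have h3 := h1.2.2
        rw [pow_succ] at h2
        simp only [hf] at h2 h3
        nlinarith
      · rw [if_neg hlast]
        have : 2 * m - 1 = j + 1 := by omega
        rw [this]
        have h3 := h1.2.2
        simp only [hf] at h3
        nlinarith

end CFlow

/-- Counting sign changes yields an alternating subsequence. -/
lemma alt_of_changes (y : ℕ → ℝ) (n : ℕ) :
    (((Finset.range n).filter fun i => y i * y (i + 1) < 0).card = 0 ∧ ∀ i ≤ n, y i = 0) ∨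
    ∃ (L : ℕ) (σ : ℕ → ℕ) (e : ℝ), (e = 1 ∨ e = -1) ∧
      ((Finset.range n).filter fun i => y i * y (i + 1) < 0).card ≤ L ∧
      (∀ j, j < L → σ j < σ (j + 1)) ∧ (∀ j ≤ L, 0 < e * (-1) ^ j * y (σ j)) ∧ σ L ≤ n ∧
      0 ≤ e * (-1) ^ L * y n := by
  induction n with
  | zero =>
    rcases lt_trichotomy (y 0) 0 with h | h | h
    · right
      exact ⟨0, fun _ => 0, -1, Or.inr rfl, by simp, by simp, by simpa using h, le_refl _,
        by simpa using h.le⟩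
    · left
      simpa using h
    · right
      exact ⟨0, fun _ => 0, 1, Or.inl rfl, by simp, by simp, by simpa using h, le_refl _,
        by simpa using h.le⟩
  | succ n ih =>
    rw [Finset.range_add_one, Finset.filter_insert]
    rcases ih with ⟨h1, h2⟩ | ⟨L, σ, e, he, hK, hs, hy, hn, hl⟩
    · have h3 : ¬ (y n * y (n + 1) < 0) := by rw [h2 n le_rfl]; simp
      rw [if_neg h3]
      rcases lt_trichotomy (y (n + 1)) 0 with h | h | h
      · right
        exact ⟨0, fun _ => n + 1, -1, Or.inr rfl, h1.le, by simp, by simpa using h, le_refl _,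
          by simpa using h.le⟩
      · left
        refine ⟨h1, fun i hi => ?_⟩
        rcases Nat.le_succ_iff.1 hi with h4 | h4
        · exact h2 i h4
        · rw [h4]; exact h
      · right
        exact ⟨0, fun _ => n + 1, 1, Or.inl rfl, h1.le, by simp, by simpa using h, le_refl _,
          by simpa using h.le⟩
    · right
      by_cases h4 : 0 ≤ e * (-1) ^ L * y (n + 1)
      · have h3 : ¬ (y n * y (n + 1) < 0) := by
          intro h5
          have h6 := mul_nonneg hl h4
          have h7 : (e * (-1) ^ L) ^ 2 = 1 := by
            rw [mul_pow, ← pow_mul, mul_comm L 2, pow_mul]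
            rcases he with rfl | rfl <;> norm_num
          nlinarith
        rw [if_neg h3]
        exact ⟨L, σ, e, he, hK, hs, hy, hn.trans (Nat.le_succ n), h4⟩
      · refine ⟨L + 1, fun j => if j ≤ L then σ j else n + 1, e, he, ?_, ?_, ?_, ?_, ?_⟩
        · split_ifs
          · exact (Finset.card_insert_le _ _).trans (by omega)
          · omega
        · intro j hj
          simp only
          rw [if_pos (by omega)]
          by_cases h5 : j + 1 ≤ L
          · rw [if_pos h5]; exact hs j (by omega)
          · rw [if_neg h5]
            have : j = L := by omega
            rw [this]; omega
        · intro j hj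
          simp only
          by_cases h5 : j ≤ L
          · rw [if_pos h5]; exact hy j h5
          · rw [if_neg h5]
            have : j = L + 1 := by omega
            rw [this, pow_succ]
            push Not at h4
            nlinarith
        · simp
        · push Not at h4
          rw [pow_succ]; nlinarith

/-- Indicator that the direction `φ` separates the angles `α, β`. -/
def sepF (α β φ : ℝ) : ℝ := if Real.cos (φ - α) * Real.cos (φ - β) < 0 then 1 else 0

lemma sepF_measurable (α β : ℝ) : Measurable (sepF α β) := by
  unfold sepF
  refine Measurable.ite ?_ measurable_const measurable_const
  exact measurableSet_lt (by fun_prop) measurable_const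

lemma sepF_bounds (α β φ : ℝ) : 0 ≤ sepF α β φ ∧ sepF α β φ ≤ 1 := by
  unfold sepF; split_ifs <;> norm_num

lemma sepF_ii (α β a b : ℝ) : IntervalIntegrable (sepF α β) volume a b := by
  refine (intervalIntegrable_const (c := (1 : ℝ))).mono_fun
    (sepF_measurable α β).aestronglyMeasurable ?_
  refine Eventually.of_forall fun x => ?_
  have := sepF_bounds α β x
  simp only [norm_one, Real.norm_eq_abs]
  rw [abs_of_nonneg this.1]; exact this.2

lemma sepF_comm (α β : ℝ) : sepF α β = sepF β α := by
  funext φ; unfold sepF; rw [mul_comm]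

lemma sepF_periodic (α β : ℝ) : Function.Periodic (sepF α β) π := by
  intro φ
  unfold sepF
  have h1 : ∀ x, Real.cos (φ + π - x) = - Real.cos (φ - x) := fun x => by
    rw [show φ + π - x = (φ - x) + π by ring, Real.cos_add_pi]
  rw [h1, h1, neg_mul_neg]

lemma sepF_integral_aux (α β : ℝ) (hab : α ≤ β) (h : β - α < π) :
    β - α ≤ ∫ φ in (0 : ℝ)..π, sepF α β φ := by
  have h1 := (sepF_periodic α β).intervalIntegral_add_eq 0 (α + π / 2)
  rw [zero_add] at h1
  rw [h1, ← intervalIntegral.integral_add_adjacent_intervals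
    (sepF_ii α β (α + π / 2) (β + π / 2)) (sepF_ii α β _ _)]
  have h2 : 0 ≤ ∫ φ in (β + π / 2)..(α + π / 2 + π), sepF α β φ :=
    intervalIntegral.integral_nonneg (by linarith) fun x _ => (sepF_bounds α β x).1
  have h3 : ∫ φ in (α + π / 2)..(β + π / 2), (1 : ℝ) ≤
      ∫ φ in (α + π / 2)..(β + π / 2), sepF α β φ := by
    refine intervalIntegral.integral_mono_on_of_le_Ioo (by linarith)
      intervalIntegrable_const (sepF_ii α β _ _) fun x hx => ?_
    have c1 : Real.cos (x - α) < 0 :=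
      Real.cos_neg_of_pi_div_two_lt_of_lt (by linarith [hx.1]) (by linarith [hx.2])
    have c2 : 0 < Real.cos (x - β) :=
      Real.cos_pos_of_mem_Ioo ⟨by linarith [hx.1], by linarith [hx.2]⟩
    unfold sepF
    rw [if_pos (mul_neg_of_neg_of_pos c1 c2)]
  rw [intervalIntegral.integral_const] at h3
  simp at h3
  linarith

lemma sepF_integral (α β : ℝ) (h : |β - α| < π) :
    |β - α| ≤ ∫ φ in (0 : ℝ)..π, sepF α β φ := by
  rcases le_total α β with hab | hab
  · rw [abs_of_nonneg (by linarith)] at h ⊢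
    exact sepF_integral_aux α β hab h
  · rw [abs_of_nonpos (by linarith)] at h ⊢
    rw [sepF_comm]
    have := sepF_integral_aux β α hab (by linarith)
    linarith

/-- Discrete total variation bound. -/
lemma discrete_tv (m : ℕ) (hm : 0 < m) (θ : ℝ → ℝ)
    (H : ∀ φ : ℝ, ∀ σ : ℕ → ℝ, (∀ j, j + 1 < 2 * m → σ j < σ (j + 1)) →
      (∀ j, j < 2 * m → 0 < (-1) ^ j * Real.cos (φ - θ (σ j))) → False)
    (n : ℕ) (x : ℕ → ℝ) (hx : StrictMono x) (hθ : ∀ i < n, |θ (x (i + 1)) - θ (x i)| < π) :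
    ∑ i ∈ Finset.range n, |θ (x (i + 1)) - θ (x i)| ≤ (2 * m - 1) * π := by
  have h1 : ∀ φ, ∑ i ∈ Finset.range n, sepF (θ (x i)) (θ (x (i + 1))) φ ≤ 2 * m - 1 := by
    intro φ
    have e1 : ∑ i ∈ Finset.range n, sepF (θ (x i)) (θ (x (i + 1))) φ =
        (((Finset.range n).filter fun i =>
          Real.cos (φ - θ (x i)) * Real.cos (φ - θ (x (i + 1))) < 0).card : ℝ) := by
      unfold sepF
      rw [Finset.sum_ite]; simp
    rw [e1]
    have e2 : (2 * m - 1 : ℝ) = ((2 * m - 1 : ℕ) : ℝ) := by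
      rw [Nat.cast_sub (by omega)]; push_cast; ring
    rw [e2]
    norm_cast
    by_contra hcon
    push Not at hcon
    rcases alt_of_changes (fun i => Real.cos (φ - θ (x i))) n with ⟨h2, _⟩ | hh
    · omega
    · obtain ⟨L, σ, e, he, hK, hs, hy, hn, hl⟩ := hh
      rcases he with rfl | rfl
      · refine H φ (fun j => x (σ j)) (fun j hj => hx (hs j (by omega))) fun j hj => ?_
        have := hy j (by omega)
        simpa using this
      · refine H (φ + π) (fun j => x (σ j)) (fun j hj => hx (hs j (by omega))) fun j hj => ?_
        have := hy j (by omega)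
        rw [show φ + π - θ (x (σ j)) = (φ - θ (x (σ j))) + π by ring, Real.cos_add_pi]
        linarith
  calc ∑ i ∈ Finset.range n, |θ (x (i + 1)) - θ (x i)|
      ≤ ∑ i ∈ Finset.range n, ∫ φ in (0 : ℝ)..π, sepF (θ (x i)) (θ (x (i + 1))) φ :=
        Finset.sum_le_sum fun i hi => sepF_integral _ _ (hθ i (Finset.mem_range.1 hi))
    _ = ∫ φ in (0 : ℝ)..π, ∑ i ∈ Finset.range n, sepF (θ (x i)) (θ (x (i + 1))) φ := by
        rw [intervalIntegral.integral_finsetSum]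
        intro i _; exact sepF_ii _ _ _ _
    _ ≤ ∫ φ in (0 : ℝ)..π, (2 * m - 1 : ℝ) := by
        refine intervalIntegral.integral_mono_on Real.pi_pos.le ?_ intervalIntegrable_const
          fun φ _ => h1 φ
        have := IntervalIntegrable.sum (μ := volume) (a := 0) (b := π) (Finset.range n)
          (f := fun i => sepF (θ (x i)) (θ (x (i + 1)))) fun i _ => sepF_ii _ _ _ _
        have e : (fun φ => ∑ i ∈ Finset.range n, sepF (θ (x i)) (θ (x (i + 1))) φ) =
            ∑ i ∈ Finset.range n, sepF (θ (x i)) (θ (x (i + 1))) := by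
          funext φ; simp
        rw [e]
        exact this
    _ = (2 * m - 1) * π := by
        rw [intervalIntegral.integral_const]; simp; ring

/-- Total variation bound for a `C¹` angle function. -/
lemma tv_bound (m : ℕ) (hm : 0 < m) (θ θ' : ℝ → ℝ) (hd : ∀ u, HasDerivAt θ (θ' u) u)
    (hc : Continuous θ')
    (H : ∀ φ : ℝ, ∀ σ : ℕ → ℝ, (∀ j, j + 1 < 2 * m → σ j < σ (j + 1)) →
      (∀ j, j < 2 * m → 0 < (-1) ^ j * Real.cos (φ - θ (σ j))) → False)
    (a b : ℝ) (hab : a < b) : ∫ u in a..b, |θ' u| ≤ (2 * m - 1) * π := by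
  have hθc : Continuous θ := continuous_iff_continuousAt.2 fun u => (hd u).continuousAt
  refine le_of_forall_pos_le_add fun ε' hε' => ?_
  obtain ⟨ε, hε, hεε⟩ : ∃ ε : ℝ, 0 < ε ∧ ε * (b - a) = ε' :=
    ⟨ε' / (b - a), div_pos hε' (by linarith), by field_simp [(by linarith : b - a ≠ 0)]⟩
  have u1 := Metric.uniformContinuousOn_iff.1
    (isCompact_Icc.uniformContinuousOn_of_continuous (s := Icc a b) hc.continuousOn) ε hε
  have u2 := Metric.uniformContinuousOn_iff.1
    (isCompact_Icc.uniformContinuousOn_of_continuous (s := Icc a b) hθc.continuousOn) π Real.pi_pos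
  obtain ⟨δ1, hδ1, u1⟩ := u1
  obtain ⟨δ2, hδ2, u2⟩ := u2
  obtain ⟨n, hn⟩ := exists_nat_gt ((b - a) / min δ1 δ2)
  have hmin : 0 < min δ1 δ2 := lt_min hδ1 hδ2
  have hn0 : (0 : ℝ) < n := lt_trans (div_pos (by linarith) hmin) hn
  set hh : ℝ := (b - a) / n with hhdef
  have hh0 : 0 < hh := div_pos (by linarith) hn0
  have hhn : n * hh = b - a := by rw [hhdef]; field_simp
  have hhlt : hh < min δ1 δ2 := by
    rw [div_lt_iff₀ hmin] at hn
    rw [hhdef, div_lt_iff₀ hn0]; linarith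
  set x : ℕ → ℝ := fun i => a + i * hh with hxdef
  have hx : StrictMono x := by
    refine strictMono_nat_of_lt_succ fun i => ?_
    simp only [hxdef]; push_cast; nlinarith
  have hxs : ∀ i, x (i + 1) - x i = hh := fun i => by simp only [hxdef]; push_cast; ring
  have hx0 : x 0 = a := by simp [hxdef]
  have hxn : x n = b := by simp only [hxdef]; linarith
  have hmem : ∀ i ≤ n, x i ∈ Icc a b := fun i hi =>
    ⟨hx0 ▸ hx.monotone (Nat.zero_le i), hxn ▸ hx.monotone hi⟩
  have hπ : ∀ i < n, |θ (x (i + 1)) - θ (x i)| < π := by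
    intro i hi
    have := u2 (x (i + 1)) (hmem _ hi) (x i) (hmem _ hi.le)
      (by rw [Real.dist_eq, hxs, abs_of_pos hh0]; exact hhlt.trans_le (min_le_right _ _))
    rwa [Real.dist_eq] at this
  have htv := discrete_tv m hm θ H n x hx hπ
  have hintg : ∀ p q : ℝ, IntervalIntegrable (fun u => |θ' u|) volume p q := fun p q =>
    hc.abs.intervalIntegrable p q
  have hsum := intervalIntegral.sum_integral_adjacent_intervals (a := x) (n := n)
    (f := fun u => |θ' u|) (μ := volume) (fun i _ => hintg _ _)
  rw [hx0, hxn] at hsum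
  rw [← hsum]
  have hpiece : ∀ i ∈ Finset.range n, ∫ u in (x i)..(x (i + 1)), |θ' u| ≤
      |θ (x (i + 1)) - θ (x i)| + ε * hh := by
    intro i hi
    have hi := Finset.mem_range.1 hi
    have hlt : x i < x (i + 1) := hx (Nat.lt_succ_self i)
    obtain ⟨ξ, hξ, hξ2⟩ := exists_hasDerivAt_eq_slope θ θ' hlt hθc.continuousOn
      (fun u _ => hd u)
    rw [hxs, eq_div_iff hh0.ne'] at hξ2
    have hsub : ∀ u ∈ Icc (x i) (x (i + 1)), u ∈ Icc a b := fun u hu =>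
      ⟨(hmem i hi.le).1.trans hu.1, hu.2.trans (hmem (i + 1) hi).2⟩
    have hb : ∀ u ∈ Icc (x i) (x (i + 1)), |θ' u| ≤ |θ' ξ| + ε := by
      intro u hu
      have h5 := u1 u (hsub u hu) ξ (hsub ξ (Ioo_subset_Icc_self hξ)) (by
        rw [Real.dist_eq, abs_lt]
        have := hhlt.trans_le (min_le_left δ1 δ2)
        have := hxs i
        constructor <;> linarith [hu.1, hu.2, hξ.1, hξ.2])
      rw [Real.dist_eq] at h5
      have := abs_sub_abs_le_abs_sub (θ' u) (θ' ξ)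
      linarith
    have h6 := intervalIntegral.integral_mono_on hlt.le (hintg _ _) intervalIntegrable_const hb
    rw [intervalIntegral.integral_const, smul_eq_mul, hxs] at h6
    rw [← hξ2, abs_mul, abs_of_pos hh0]
    linarith
  have := Finset.sum_le_sum hpiece
  rw [Finset.sum_add_distrib, Finset.sum_const, Finset.card_range, nsmul_eq_mul] at this
  nlinarith

lemma no_dir_neg (m : ℕ) (hm : 0 < m) {X Y g c s k : ℝ → ℝ → ℝ}
    (hC : ∀ x₀ y₀ : ℝ, CFlow (2 * m * Real.sqrt π) (fun u t => X u t - x₀) (fun u t => Y u t - y₀)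
      g c s k) (t : ℝ) (ht : t < 0) (φ : ℝ) (σ : ℕ → ℝ)
    (hσ : ∀ j, j + 1 < 2 * m → σ j < σ (j + 1))
    (hz : ∀ j, j < 2 * m →
      0 < (-1) ^ j * (c (σ j) t * Real.cos φ + s (σ j) t * Real.sin φ)) : False := by
  have h1 : ∀ j ∈ Finset.range (2 * m), ∀ᶠ Λ : ℝ in atTop,
      0 < (-1) ^ j * (X (σ j) t * c (σ j) t + Y (σ j) t * s (σ j) t) +
        Λ * ((-1) ^ j * (c (σ j) t * Real.cos φ + s (σ j) t * Real.sin φ)) := by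
    intro j hj
    have h2 := hz j (Finset.mem_range.1 hj)
    have h3 : Tendsto (fun Λ : ℝ => (-1) ^ j * (X (σ j) t * c (σ j) t + Y (σ j) t * s (σ j) t) +
        Λ * ((-1) ^ j * (c (σ j) t * Real.cos φ + s (σ j) t * Real.sin φ))) atTop atTop :=
      tendsto_atTop_add_const_left _ _ (tendsto_id.atTop_mul_const h2)
    exact h3.eventually_gt_atTop 0
  obtain ⟨Λ, hΛ⟩ := ((Finset.eventually_all _).2 h1).exists
  refine (hC (-(Λ * Real.cos φ)) (-(Λ * Real.sin φ))).no_alt m hm t ht σ hσ fun j hj => ?_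
  have := hΛ j (Finset.mem_range.2 hj)
  simp only [zF]
  refine this.trans_eq ?_
  ring

lemma no_dir (m : ℕ) (hm : 0 < m) {X Y g c s k : ℝ → ℝ → ℝ}
    (hC : ∀ x₀ y₀ : ℝ, CFlow (2 * m * Real.sqrt π) (fun u t => X u t - x₀) (fun u t => Y u t - y₀)
      g c s k)
    (hc0 : ∀ u, Tendsto (fun t => c u t) (nhdsWithin 0 (Iio 0)) (nhds (c u 0)))
    (hs0 : ∀ u, Tendsto (fun t => s u t) (nhdsWithin 0 (Iio 0)) (nhds (s u 0)))
    (t : ℝ) (ht : t ≤ 0) (φ : ℝ) (σ : ℕ → ℝ)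
    (hσ : ∀ j, j + 1 < 2 * m → σ j < σ (j + 1))
    (hz : ∀ j, j < 2 * m →
      0 < (-1) ^ j * (c (σ j) t * Real.cos φ + s (σ j) t * Real.sin φ)) : False := by
  rcases ht.lt_or_eq with h | rfl
  · exact no_dir_neg m hm hC t h φ σ hσ hz
  · have h1 : ∀ j ∈ Finset.range (2 * m), ∀ᶠ t : ℝ in nhdsWithin 0 (Iio 0),
        0 < (-1) ^ j * (c (σ j) t * Real.cos φ + s (σ j) t * Real.sin φ) := by
      intro j hj
      have h2 := hz j (Finset.mem_range.1 hj)
      have h3 := (((hc0 (σ j)).mul_const (Real.cos φ)).add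
        ((hs0 (σ j)).mul_const (Real.sin φ))).const_mul ((-1 : ℝ) ^ j)
      exact h3.eventually (lt_mem_nhds h2)
    obtain ⟨t, ht, ht2⟩ := (((Finset.eventually_all _).2 h1).and self_mem_nhdsWithin).exists
    exact no_dir_neg m hm hC t ht2 φ σ hσ fun j hj => ht j (Finset.mem_range.2 hj)

lemma exists_angle (c s : ℝ) (h : c ^ 2 + s ^ 2 = 1) : ∃ θ, Real.cos θ = c ∧ Real.sin θ = s := by
  have h1 : -1 ≤ c := by nlinarith [sq_nonneg s]
  have h2 : c ≤ 1 := by nlinarith [sq_nonneg s]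
  have h3 : Real.sqrt (1 - c ^ 2) = |s| := by
    rw [show 1 - c ^ 2 = s ^ 2 by linarith, Real.sqrt_sq_eq_abs]
  rcases le_total 0 s with hs | hs
  · exact ⟨Real.arccos c, Real.cos_arccos h1 h2, by
      rw [Real.sin_arccos, h3, abs_of_nonneg hs]⟩
  · exact ⟨-Real.arccos c, by rw [Real.cos_neg, Real.cos_arccos h1 h2], by
      rw [Real.sin_neg, Real.sin_arccos, h3, abs_of_nonpos hs, neg_neg]⟩

lemma exists_lift (c s q : ℝ → ℝ) (hq : Continuous q) (hcs : ∀ u, c u ^ 2 + s u ^ 2 = 1)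
    (hc : ∀ u, HasDerivAt c (-(q u * s u)) u) (hs : ∀ u, HasDerivAt s (q u * c u) u) :
    ∃ θ : ℝ → ℝ, (∀ u, HasDerivAt θ (q u) u) ∧ (∀ u, Real.cos (θ u) = c u) ∧
      ∀ u, Real.sin (θ u) = s u := by
  obtain ⟨θ₀, h1, h2⟩ := exists_angle (c 0) (s 0) (hcs 0)
  set θ : ℝ → ℝ := fun u => θ₀ + ∫ v in (0 : ℝ)..u, q v with hθ
  have hd : ∀ u, HasDerivAt θ (q u) u := fun u =>
    (intervalIntegral.integral_hasDerivAt_right (hq.intervalIntegrable _ _)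
      (hq.stronglyMeasurableAtFilter _ _) hq.continuousAt).const_add θ₀
  have hA : ∀ u, HasDerivAt (fun u => c u * Real.cos (θ u) + s u * Real.sin (θ u)) 0 u := by
    intro u
    refine (((hc u).mul (hd u).cos).add ((hs u).mul (hd u).sin)).congr_deriv ?_
    ring
  have hB : ∀ u, HasDerivAt (fun u => s u * Real.cos (θ u) - c u * Real.sin (θ u)) 0 u := by
    intro u
    refine (((hs u).mul (hd u).cos).sub ((hc u).mul (hd u).sin)).congr_deriv ?_
    ring
  have hθ0 : θ 0 = θ₀ := by simp [hθ]
  have cA : ∀ u, c u * Real.cos (θ u) + s u * Real.sin (θ u) = 1 := by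
    intro u
    have := is_const_of_deriv_eq_zero (fun x => (hA x).differentiableAt)
      (fun x => (hA x).deriv) u 0
    simp only [hθ0, h1, h2] at this
    rw [this]; nlinarith [hcs 0]
  have cB : ∀ u, s u * Real.cos (θ u) - c u * Real.sin (θ u) = 0 := by
    intro u
    have := is_const_of_deriv_eq_zero (fun x => (hB x).differentiableAt)
      (fun x => (hB x).deriv) u 0
    simp only [hθ0, h1, h2] at this
    rw [this]; ring
  refine ⟨θ, hd, fun u => ?_, fun u => ?_⟩
  · linear_combination c u * cA u + (s u) * cB u - Real.cos (θ u) * hcs u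
  · linear_combination s u * cA u - (c u) * cB u - Real.sin (θ u) * hcs u

/-- Bound for the total curvature on compact parameter intervals. -/
lemma curv_bound (m : ℕ) (hm : 0 < m) {X Y g c s k : ℝ → ℝ → ℝ}
    (hC : ∀ x₀ y₀ : ℝ, CFlow (2 * m * Real.sqrt π) (fun u t => X u t - x₀) (fun u t => Y u t - y₀)
      g c s k)
    (hc0 : ∀ u, Tendsto (fun t => c u t) (nhdsWithin 0 (Iio 0)) (nhds (c u 0)))
    (hs0 : ∀ u, Tendsto (fun t => s u t) (nhdsWithin 0 (Iio 0)) (nhds (s u 0)))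
    (t : ℝ) (ht : t ≤ 0) (hq : Continuous fun u => g u t * k u t)
    (hcs : ∀ u, c u t ^ 2 + s u t ^ 2 = 1)
    (hc : ∀ u, HasDerivAt (fun v => c v t) (-(g u t * k u t * s u t)) u)
    (hs : ∀ u, HasDerivAt (fun v => s v t) (g u t * k u t * c u t) u)
    (a b : ℝ) (hab : a < b) : ∫ u in a..b, |g u t * k u t| ≤ (2 * m - 1) * π := by
  obtain ⟨θ, hd, h1, h2⟩ := exists_lift (fun u => c u t) (fun u => s u t)
    (fun u => g u t * k u t) hq hcs hc hs
  refine tv_bound m hm θ _ hd hq (fun φ σ hσ hz => ?_) a b hab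
  refine no_dir m hm hC hc0 hs0 t ht φ σ hσ fun j hj => ?_
  have := hz j hj
  rw [Real.cos_sub, h1, h2] at this
  linarith

/-- The space-time domain. -/
def STset : Set (ℝ × ℝ) := univ ×ˢ Iic 0

lemma mem_STset {u t : ℝ} (ht : t ≤ 0) : (u, t) ∈ STset := ⟨mem_univ _, ht⟩

lemma STset_unique : UniqueDiffOn ℝ STset := uniqueDiffOn_univ.prod (uniqueDiffOn_Iic 0)

lemma STset_nhds {u t : ℝ} (ht : t < 0) : STset ∈ nhds (u, t) :=
  prod_mem_nhds univ_mem (Iic_mem_nhds ht)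

/-- Smoothness up to the final time. -/
def SmoothST (F : ℝ → ℝ → ℝ) : Prop :=
  ContDiffOn ℝ (⊤ : ℕ∞) (fun p : ℝ × ℝ => F p.1 p.2) STset

namespace SmoothST

variable {F G : ℝ → ℝ → ℝ}

lemma hasDerivAt_aux (h : SmoothST F) (u t : ℝ) (ht : t ≤ 0) :
    HasDerivAt (fun v => F v t)
      (fderivWithin ℝ (fun p : ℝ × ℝ => F p.1 p.2) STset (u, t) (1, 0)) u := by
  have h1 : HasDerivWithinAt (fun v : ℝ => ((v, t) : ℝ × ℝ)) ((1 : ℝ), (0 : ℝ)) univ u :=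
    ((hasDerivAt_id u).prodMk (hasDerivAt_const u t)).hasDerivWithinAt
  have h2 := ((h.differentiableOn (by simp)) (u, t) (mem_STset ht)).hasFDerivWithinAt
  have h3 := h2.comp_hasDerivWithinAt u h1 (fun v _ => mem_STset ht)
  exact h3.hasDerivAt univ_mem

lemma hasDerivAt (h : SmoothST F) (u t : ℝ) (ht : t ≤ 0) :
    HasDerivAt (fun v => F v t) (deriv (fun v => F v t) u) u :=
  (h.hasDerivAt_aux u t ht).differentiableAt.hasDerivAt

lemma deriv_smooth (h : SmoothST F) : SmoothST (fun u t => deriv (fun v => F v t) u) := by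
  have h1 : ContDiffOn ℝ (⊤ : ℕ∞)
      (fun p => fderivWithin ℝ (fun p : ℝ × ℝ => F p.1 p.2) STset p (1, 0)) STset :=
    (ContDiffOn.fderivWithin h STset_unique (by simp)).clm_apply contDiffOn_const
  refine h1.congr fun p hp => ?_
  exact (h.hasDerivAt_aux p.1 p.2 hp.2).deriv

lemma mul (hF : SmoothST F) (hG : SmoothST G) : SmoothST (fun u t => F u t * G u t) :=
  ContDiffOn.mul hF hG
lemma add (hF : SmoothST F) (hG : SmoothST G) : SmoothST (fun u t => F u t + G u t) :=
  ContDiffOn.add hF hG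
lemma sub (hF : SmoothST F) (hG : SmoothST G) : SmoothST (fun u t => F u t - G u t) :=
  ContDiffOn.sub hF hG
lemma div (hF : SmoothST F) (hG : SmoothST G) (h0 : ∀ u t, t ≤ 0 → G u t ≠ 0) :
    SmoothST (fun u t => F u t / G u t) :=
  ContDiffOn.div hF hG fun p hp => h0 p.1 p.2 hp.2
lemma sqrt (hF : SmoothST F) (h0 : ∀ u t, t ≤ 0 → F u t ≠ 0) :
    SmoothST (fun u t => Real.sqrt (F u t)) :=
  ContDiffOn.sqrt hF fun p hp => h0 p.1 p.2 hp.2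

lemma contDiffAt (h : SmoothST F) (u t : ℝ) (ht : t < 0) :
    ContDiffAt ℝ (⊤ : ℕ∞) (fun p : ℝ × ℝ => F p.1 p.2) (u, t) :=
  ContDiffOn.contDiffAt h (STset_nhds ht)

lemma differentiableAt (h : SmoothST F) (u t : ℝ) (ht : t < 0) :
    DifferentiableAt ℝ (fun p : ℝ × ℝ => F p.1 p.2) (u, t) :=
  (h.contDiffAt u t ht).differentiableAt (by simp)

lemma cont_u (h : SmoothST F) (t : ℝ) (ht : t ≤ 0) : Continuous (fun u => F u t) :=
  continuous_iff_continuousAt.2 fun u => (h.hasDerivAt u t ht).continuousAt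

lemma tendsto_zero (h : SmoothST F) (u : ℝ) :
    Tendsto (fun t => F u t) (nhdsWithin 0 (Iio 0)) (nhds (F u 0)) := by
  have h1 := (ContDiffOn.continuousOn h) (u, 0) (mem_STset le_rfl)
  have h2 : Tendsto (fun t : ℝ => ((u, t) : ℝ × ℝ)) (nhdsWithin 0 (Iio 0))
      (nhdsWithin (u, 0) STset) := by
    refine tendsto_nhdsWithin_of_tendsto_nhds_of_eventually_within _ ?_ ?_
    · exact (by fun_prop : Continuous fun t : ℝ => ((u, t) : ℝ × ℝ)).continuousAt.mono_left
        nhdsWithin_le_nhds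
    · filter_upwards [self_mem_nhdsWithin] with t ht
      exact mem_STset (le_of_lt ht)
  have h3 := h1.tendsto.comp h2
  exact h3

end SmoothST

lemma clm_eval_deriv {G : ℝ → (ℝ × ℝ →L[ℝ] ℝ)} {G' : ℝ × ℝ →L[ℝ] ℝ} {x : ℝ}
    (h : HasDerivAt G G' x) (w : ℝ × ℝ) : HasDerivAt (fun v => G v w) (G' w) x :=
  (ContinuousLinearMap.apply ℝ ℝ w).hasFDerivAt.comp_hasDerivAt x h

/-- Symmetry of mixed partials, in the form needed. -/
lemma mixed_partial {F : ℝ × ℝ → ℝ} {u t d : ℝ} {p A : ℝ → ℝ}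
    (hF : ContDiffAt ℝ (⊤ : ℕ∞) F (u, t))
    (hp : ∀ᶠ r in nhds t, fderiv ℝ F (u, r) (1, 0) = p r)
    (hA : ∀ v, fderiv ℝ F (v, t) (0, 1) = A v) (hAd : HasDerivAt A d u) : HasDerivAt p d t := by
  have h1 : DifferentiableAt ℝ (fderiv ℝ F) (u, t) :=
    (hF.fderiv_right (m := 1) (by norm_cast)).differentiableAt (by simp)
  have hsym : IsSymmSndFDerivAt ℝ F (u, t) := hF.isSymmSndFDerivAt (by
    rw [minSmoothness_of_isRCLikeNormedField]
    exact WithTop.coe_le_coe.2 (le_top : (2 : ℕ∞) ≤ ⊤))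
  have hv : HasDerivAt (fun v : ℝ => ((v, t) : ℝ × ℝ)) ((1 : ℝ), (0 : ℝ)) u :=
    (hasDerivAt_id u).prodMk (hasDerivAt_const u t)
  have hr : HasDerivAt (fun v : ℝ => ((u, v) : ℝ × ℝ)) ((0 : ℝ), (1 : ℝ)) t :=
    (hasDerivAt_const t u).prodMk (hasDerivAt_id t)
  have e1 : HasDerivAt (fun v => fderiv ℝ F (v, t) (0, 1))
      (fderiv ℝ (fderiv ℝ F) (u, t) (1, 0) (0, 1)) u := by
    exact clm_eval_deriv (h1.hasFDerivAt.comp_hasDerivAt u hv) ((0 : ℝ), (1 : ℝ))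
  have e2 : HasDerivAt (fun r => fderiv ℝ F (u, r) (1, 0))
      (fderiv ℝ (fderiv ℝ F) (u, t) (0, 1) (1, 0)) t := by
    exact clm_eval_deriv (h1.hasFDerivAt.comp_hasDerivAt t hr) ((1 : ℝ), (0 : ℝ))
  have e3 : d = fderiv ℝ (fderiv ℝ F) (u, t) (1, 0) (0, 1) := by
    have : (fun v => fderiv ℝ F (v, t) (0, 1)) = A := funext hA
    rw [this] at e1
    exact hAd.unique e1
  rw [e3, hsym.eq]
  exact e2.congr_of_eventuallyEq (hp.mono fun r hr => hr.symm)

lemma euclid_hasDerivAt {f : ℝ → R2} {d : R2} {u : ℝ} (hf : HasDerivAt f d u) (i : Fin 2) :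
    HasDerivAt (fun v => f v i) (d i) u :=
  (EuclideanSpace.proj (𝕜 := ℝ) i : R2 →L[ℝ] ℝ).hasFDerivAt.comp_hasDerivAt u hf

lemma euclid_deriv {f : ℝ → R2} {u : ℝ} (hf : DifferentiableAt ℝ f u) (i : Fin 2) :
    (deriv f u) i = deriv (fun v => f v i) u :=
  (euclid_hasDerivAt hf.hasDerivAt i).deriv.symm

lemma euclid_norm (v : R2) : ‖v‖ = Real.sqrt (v 0 * v 0 + v 1 * v 1) := by
  rw [EuclideanSpace.norm_eq]; simp [Fin.sum_univ_two, pow_two]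

/-- First coordinate. -/
def gX (γ : ℝ → ℝ → R2) (u t : ℝ) : ℝ := γ u t 0
/-- Second coordinate. -/
def gY (γ : ℝ → ℝ → R2) (u t : ℝ) : ℝ := γ u t 1
/-- Derivative of the first coordinate. -/
def gp (γ : ℝ → ℝ → R2) (u t : ℝ) : ℝ := deriv (fun v => gX γ v t) u
/-- Derivative of the second coordinate. -/
def gq (γ : ℝ → ℝ → R2) (u t : ℝ) : ℝ := deriv (fun v => gY γ v t) u
/-- Speed. -/
def gg (γ : ℝ → ℝ → R2) (u t : ℝ) : ℝ :=
  Real.sqrt (gp γ u t * gp γ u t + gq γ u t * gq γ u t)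
/-- First coordinate of the tangent. -/
def gc (γ : ℝ → ℝ → R2) (u t : ℝ) : ℝ := gp γ u t / gg γ u t
/-- Second coordinate of the tangent. -/
def gs (γ : ℝ → ℝ → R2) (u t : ℝ) : ℝ := gq γ u t / gg γ u t
/-- Curvature in coordinates. -/
def gk (γ : ℝ → ℝ → R2) (u t : ℝ) : ℝ :=
  (gc γ u t * deriv (fun v => gs γ v t) u - gs γ u t * deriv (fun v => gc γ v t) u) / gg γ u t

namespace IsCSF

variable {γ : ℝ → ℝ → R2}

lemma sX (h : IsCSF γ (Iic 0)) : SmoothST (gX γ) := (contDiffOn_euclidean.1 h.smooth) 0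
lemma sY (h : IsCSF γ (Iic 0)) : SmoothST (gY γ) := (contDiffOn_euclidean.1 h.smooth) 1
lemma sp (h : IsCSF γ (Iic 0)) : SmoothST (gp γ) := h.sX.deriv_smooth
lemma sq (h : IsCSF γ (Iic 0)) : SmoothST (gq γ) := h.sY.deriv_smooth

lemma diffu (h : IsCSF γ (Iic 0)) (u t : ℝ) (ht : t ≤ 0) :
    DifferentiableAt ℝ (fun v => γ v t) u := by
  refine differentiableAt_euclidean.2 fun i => ?_
  fin_cases i
  · exact (h.sX.hasDerivAt u t ht).differentiableAt
  · exact (h.sY.hasDerivAt u t ht).differentiableAt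

lemma deriv0 (h : IsCSF γ (Iic 0)) (u t : ℝ) (ht : t ≤ 0) :
    (deriv (fun v => γ v t) u) 0 = gp γ u t := euclid_deriv (h.diffu u t ht) 0
lemma deriv1 (h : IsCSF γ (Iic 0)) (u t : ℝ) (ht : t ≤ 0) :
    (deriv (fun v => γ v t) u) 1 = gq γ u t := euclid_deriv (h.diffu u t ht) 1

lemma speed (h : IsCSF γ (Iic 0)) (u t : ℝ) (ht : t ≤ 0) :
    ‖deriv (fun v => γ v t) u‖ = gg γ u t := by
  rw [euclid_norm, h.deriv0 u t ht, h.deriv1 u t ht]; rfl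

lemma gpos (h : IsCSF γ (Iic 0)) (u t : ℝ) (ht : t ≤ 0) : 0 < gg γ u t := by
  rw [← h.speed u t ht]
  exact norm_pos_iff.2 (h.regular u t ht)

lemma gsq (h : IsCSF γ (Iic 0)) (u t : ℝ) :
    gg γ u t ^ 2 = gp γ u t ^ 2 + gq γ u t ^ 2 := by
  unfold gg
  rw [Real.sq_sqrt (by nlinarith [sq_nonneg (gp γ u t), sq_nonneg (gq γ u t)])]
  ring

lemma sg (h : IsCSF γ (Iic 0)) : SmoothST (gg γ) := by
  refine ((h.sp.mul h.sp).add (h.sq.mul h.sq)).sqrt fun u t ht => ?_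
  have := h.gpos u t ht
  have h2 := h.gsq u t
  nlinarith

lemma sc (h : IsCSF γ (Iic 0)) : SmoothST (gc γ) :=
  h.sp.div h.sg fun u t ht => (h.gpos u t ht).ne'
lemma ss (h : IsCSF γ (Iic 0)) : SmoothST (gs γ) :=
  h.sq.div h.sg fun u t ht => (h.gpos u t ht).ne'
lemma sk (h : IsCSF γ (Iic 0)) : SmoothST (gk γ) :=
  ((h.sc.mul h.ss.deriv_smooth).sub (h.ss.mul h.sc.deriv_smooth)).div h.sg
    fun u t ht => (h.gpos u t ht).ne'

lemma cs (h : IsCSF γ (Iic 0)) (u t : ℝ) (ht : t ≤ 0) : gc γ u t ^ 2 + gs γ u t ^ 2 = 1 := by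
  have := h.gpos u t ht
  have h2 := h.gsq u t
  unfold gc gs
  rw [div_pow, div_pow, ← add_div, ← h2, div_self (by positivity)]

lemma cs_deriv (h : IsCSF γ (Iic 0)) (u t : ℝ) (ht : t ≤ 0) :
    gc γ u t * deriv (fun v => gc γ v t) u + gs γ u t * deriv (fun v => gs γ v t) u = 0 := by
  have h1 := ((h.sc.hasDerivAt u t ht).pow 2).add ((h.ss.hasDerivAt u t ht).pow 2)
  have h2 : HasDerivAt (fun v => gc γ v t ^ 2 + gs γ v t ^ 2) 0 u := by
    have : (fun v => gc γ v t ^ 2 + gs γ v t ^ 2) = fun _ => (1 : ℝ) :=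
      funext fun v => h.cs v t ht
    rw [this]; exact hasDerivAt_const u 1
  have h3 := h1.unique h2
  simp at h3
  linarith

lemma gk_mul (h : IsCSF γ (Iic 0)) (u t : ℝ) (ht : t ≤ 0) :
    gg γ u t * gk γ u t =
      gc γ u t * deriv (fun v => gs γ v t) u - gs γ u t * deriv (fun v => gc γ v t) u := by
  unfold gk
  have := h.gpos u t ht
  field_simp

lemma dcu (h : IsCSF γ (Iic 0)) (u t : ℝ) (ht : t ≤ 0) :
    deriv (fun v => gc γ v t) u = -(gg γ u t * gk γ u t * gs γ u t) := by
  rw [h.gk_mul u t ht]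
  linear_combination -deriv (fun v => gc γ v t) u * h.cs u t ht + gc γ u t * h.cs_deriv u t ht

lemma dsu (h : IsCSF γ (Iic 0)) (u t : ℝ) (ht : t ≤ 0) :
    deriv (fun v => gs γ v t) u = gg γ u t * gk γ u t * gc γ u t := by
  rw [h.gk_mul u t ht]
  linear_combination -deriv (fun v => gs γ v t) u * h.cs u t ht + gs γ u t * h.cs_deriv u t ht

lemma cu (h : IsCSF γ (Iic 0)) (u t : ℝ) (ht : t ≤ 0) :
    HasDerivAt (fun v => gc γ v t) (-(gg γ u t * gk γ u t * gs γ u t)) u :=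
  h.dcu u t ht ▸ h.sc.hasDerivAt u t ht
lemma su (h : IsCSF γ (Iic 0)) (u t : ℝ) (ht : t ≤ 0) :
    HasDerivAt (fun v => gs γ v t) (gg γ u t * gk γ u t * gc γ u t) u :=
  h.dsu u t ht ▸ h.ss.hasDerivAt u t ht

lemma unitT0 (h : IsCSF γ (Iic 0)) (u t : ℝ) (ht : t ≤ 0) : (aderiv γ γ u t) 0 = gc γ u t := by
  unfold aderiv
  rw [h.speed u t ht, PiLp.smul_apply, h.deriv0 u t ht, smul_eq_mul]
  unfold gc; field_simp

lemma unitT1 (h : IsCSF γ (Iic 0)) (u t : ℝ) (ht : t ≤ 0) : (aderiv γ γ u t) 1 = gs γ u t := by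
  unfold aderiv
  rw [h.speed u t ht, PiLp.smul_apply, h.deriv1 u t ht, smul_eq_mul]
  unfold gs; field_simp

lemma diffT (h : IsCSF γ (Iic 0)) (u t : ℝ) (ht : t ≤ 0) :
    DifferentiableAt ℝ (fun v => aderiv γ γ v t) u := by
  refine differentiableAt_euclidean.2 fun i => ?_
  fin_cases i
  · have : (fun v => (aderiv γ γ v t) 0) = fun v => gc γ v t := funext fun v => h.unitT0 v t ht
    exact this ▸ (h.cu u t ht).differentiableAt
  · have : (fun v => (aderiv γ γ v t) 1) = fun v => gs γ v t := funext fun v => h.unitT1 v t ht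
    exact this ▸ (h.su u t ht).differentiableAt

lemma kvec0 (h : IsCSF γ (Iic 0)) (u t : ℝ) (ht : t ≤ 0) :
    (aderiv γ (aderiv γ γ) u t) 0 = -(gk γ u t * gs γ u t) := by
  have h0 := h.gpos u t ht
  rw [aderiv, h.speed u t ht, PiLp.smul_apply, euclid_deriv (h.diffT u t ht), smul_eq_mul]
  have : (fun v => (aderiv γ γ v t) 0) = fun v => gc γ v t := funext fun v => h.unitT0 v t ht
  rw [this, h.dcu u t ht]
  field_simp

lemma kvec1 (h : IsCSF γ (Iic 0)) (u t : ℝ) (ht : t ≤ 0) :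
    (aderiv γ (aderiv γ γ) u t) 1 = gk γ u t * gc γ u t := by
  have h0 := h.gpos u t ht
  rw [aderiv, h.speed u t ht, PiLp.smul_apply, euclid_deriv (h.diffT u t ht), smul_eq_mul]
  have : (fun v => (aderiv γ γ v t) 1) = fun v => gs γ v t := funext fun v => h.unitT1 v t ht
  rw [this, h.dsu u t ht]
  field_simp

lemma curv_eq (h : IsCSF γ (Iic 0)) (u t : ℝ) (ht : t ≤ 0) : curv γ u t = gk γ u t := by
  have e0 : (unitN γ u t) 0 = - gs γ u t := by
    unfold unitN Jrot toR2 unitT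
    rw [← h.unitT1 u t ht]; simp
  have e1 : (unitN γ u t) 1 = gc γ u t := by
    unfold unitN Jrot toR2 unitT
    rw [← h.unitT0 u t ht]; simp
  have k0 := h.kvec0 u t ht
  have k1 := h.kvec1 u t ht
  unfold curv
  rw [PiLp.inner_apply, Fin.sum_univ_two, e0, e1]
  change inner ℝ ((aderiv γ (aderiv γ γ) u t) 0) _ + inner ℝ ((aderiv γ (aderiv γ γ) u t) 1) _ = _
  rw [k0, k1]
  simp only [RCLike.inner_apply, conj_trivial]
  linear_combination gk γ u t * h.cs u t ht

lemma tderiv (h : IsCSF γ (Iic 0)) (u t : ℝ) (ht : t < 0) :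
    HasDerivAt (fun r => γ u r) (aderiv γ (aderiv γ γ) u t) t := by
  have hd : DifferentiableAt ℝ (fun r => γ u r) t := by
    refine differentiableAt_euclidean.2 fun i => ?_
    have hr : DifferentiableAt ℝ (fun v : ℝ => ((u, v) : ℝ × ℝ)) t := by fun_prop
    fin_cases i
    · exact (h.sX.differentiableAt u t ht).comp t hr
    · exact (h.sY.differentiableAt u t ht).comp t hr
  have h1 := h.flow u t ht.le
  rw [derivWithin_of_mem_nhds (Iic_mem_nhds ht)] at h1
  rw [← h1]; exact hd.hasDerivAt

lemma Xt (h : IsCSF γ (Iic 0)) (u t : ℝ) (ht : t < 0) :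
    HasDerivAt (fun r => gX γ u r) (-(gk γ u t * gs γ u t)) t :=
  h.kvec0 u t ht.le ▸ euclid_hasDerivAt (h.tderiv u t ht) 0
lemma Yt (h : IsCSF γ (Iic 0)) (u t : ℝ) (ht : t < 0) :
    HasDerivAt (fun r => gY γ u r) (gk γ u t * gc γ u t) t :=
  h.kvec1 u t ht.le ▸ euclid_hasDerivAt (h.tderiv u t ht) 1

lemma pt (h : IsCSF γ (Iic 0)) (u t : ℝ) (ht : t < 0) :
    HasDerivAt (fun r => gp γ u r) (-(deriv (fun v => gk γ v t) u * gs γ u t +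
      gk γ u t * (gg γ u t * gk γ u t * gc γ u t))) t := by
  refine mixed_partial (h.sX.contDiffAt u t ht) ?_
    (fun v => fderiv_snd_of (h.sX.differentiableAt v t ht) (h.Xt v t ht))
    ((h.sk.hasDerivAt u t ht.le).mul (h.su u t ht.le)).neg
  filter_upwards [Iio_mem_nhds ht] with r hr
  exact fderiv_fst_of (h.sX.differentiableAt u r hr) (h.sX.hasDerivAt u r (le_of_lt hr))

lemma qt (h : IsCSF γ (Iic 0)) (u t : ℝ) (ht : t < 0) :
    HasDerivAt (fun r => gq γ u r) (deriv (fun v => gk γ v t) u * gc γ u t +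
      gk γ u t * (-(gg γ u t * gk γ u t * gs γ u t))) t := by
  refine mixed_partial (h.sY.contDiffAt u t ht) ?_
    (fun v => fderiv_snd_of (h.sY.differentiableAt v t ht) (h.Yt v t ht))
    ((h.sk.hasDerivAt u t ht.le).mul (h.cu u t ht.le))
  filter_upwards [Iio_mem_nhds ht] with r hr
  exact fderiv_fst_of (h.sY.differentiableAt u r hr) (h.sY.hasDerivAt u r (le_of_lt hr))

lemma p_eq (h : IsCSF γ (Iic 0)) (u t : ℝ) (ht : t ≤ 0) : gp γ u t = gg γ u t * gc γ u t := by
  have := h.gpos u t ht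
  unfold gc; field_simp
lemma q_eq (h : IsCSF γ (Iic 0)) (u t : ℝ) (ht : t ≤ 0) : gq γ u t = gg γ u t * gs γ u t := by
  have := h.gpos u t ht
  unfold gs; field_simp

lemma g_t (h : IsCSF γ (Iic 0)) (u t : ℝ) (ht : t < 0) :
    HasDerivAt (fun r => gg γ u r) (-(gg γ u t * gk γ u t ^ 2)) t := by
  have h0 := h.gpos u t ht.le
  have h2 := h.gsq u t
  have hp := h.pt u t ht
  have hq := h.qt u t ht
  have h1 := ((hp.mul hp).add (hq.mul hq)).sqrt
    (by simp only [Pi.add_apply, Pi.mul_apply]; nlinarith)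
  refine h1.congr_deriv ?_
  have e : Real.sqrt (((fun r => gp γ u r) * (fun r => gp γ u r) +
    (fun r => gq γ u r) * fun r => gq γ u r) t) = gg γ u t := rfl
  rw [e, div_eq_iff (by positivity), h.p_eq u t ht.le, h.q_eq u t ht.le]
  linear_combination (-2 * gg γ u t ^ 2 * gk γ u t ^ 2) * h.cs u t ht.le

end IsCSF

lemma toR2_zero (x y : ℝ) : (toR2 x y) 0 = x := by simp [toR2]
lemma toR2_one (x y : ℝ) : (toR2 x y) 1 = y := by simp [toR2]

lemma norm_sub_toR2_sq (v : R2) (x y : ℝ) :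
    ‖v - toR2 x y‖ ^ 2 = (v 0 - x) ^ 2 + (v 1 - y) ^ 2 := by
  rw [EuclideanSpace.norm_sq_eq, Fin.sum_univ_two, PiLp.sub_apply, PiLp.sub_apply,
    toR2_zero, toR2_one]
  simp

namespace IsCSF

variable {γ : ℝ → ℝ → R2}

lemma ent_bound (h : IsCSF γ (Iic 0)) (m : ℕ) (hEnt : entropyE γ (Iic 0) = (m : ℝ≥0∞))
    (x₀ y₀ t : ℝ) (ht : t ≤ 0) (l : ℝ) (hl : 0 < l) (a b : ℝ) (hab : a ≤ b) :
    ∫ u in a..b, Real.exp (-((gX γ u t - x₀) ^ 2 + (gY γ u t - y₀) ^ 2) / (4 * l)) * gg γ u t ≤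
      2 * m * Real.sqrt π * Real.sqrt l := by
  have h1 : gaussLenE γ (toR2 x₀ y₀) l t ≤ m := by
    rw [← hEnt]
    unfold entropyE
    exact le_iSup₂_of_le t ht (le_iSup_of_le (toR2 x₀ y₀) (le_iSup₂_of_le l hl le_rfl))
  unfold gaussLenE at h1
  set S := Real.sqrt (4 * π * l) with hS
  have hS0 : 0 < S := Real.sqrt_pos.2 (by positivity)
  have hSe : S = 2 * Real.sqrt π * Real.sqrt l := by
    rw [hS, Real.sqrt_mul (by positivity), Real.sqrt_mul (by norm_num),
      show (4 : ℝ) = 2 ^ 2 by norm_num, Real.sqrt_sq (by norm_num)]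
  set f : ℝ → ℝ := fun u =>
    Real.exp (-((gX γ u t - x₀) ^ 2 + (gY γ u t - y₀) ^ 2) / (4 * l)) * gg γ u t with hf
  have hfc : Continuous f := by
    have c1 := h.sX.cont_u t ht
    have c2 := h.sY.cont_u t ht
    have c3 := h.sg.cont_u t ht
    fun_prop
  have hf0 : ∀ u, 0 ≤ f u := fun u => mul_nonneg (Real.exp_pos _).le (h.gpos u t ht).le
  have h2 : (∫⁻ u : ℝ, ENNReal.ofReal
      (Real.exp (-‖γ u t - toR2 x₀ y₀‖ ^ 2 / (4 * l)) * ‖deriv (fun v => γ v t) u‖)) =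
      ∫⁻ u : ℝ, ENNReal.ofReal (f u) := by
    refine lintegral_congr fun u => ?_
    rw [h.speed u t ht, norm_sub_toR2_sq]
    rfl
  rw [h2] at h1
  have h3 : ∫⁻ u : ℝ, ENNReal.ofReal (f u) ≤ ENNReal.ofReal (S * m) := by
    rw [ENNReal.ofReal_mul hS0.le, ENNReal.ofReal_natCast]
    calc ∫⁻ u : ℝ, ENNReal.ofReal (f u)
        = ENNReal.ofReal S * ((ENNReal.ofReal S)⁻¹ * ∫⁻ u : ℝ, ENNReal.ofReal (f u)) := by
          rw [← mul_assoc, ENNReal.mul_inv_cancel, one_mul]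
          · exact (ENNReal.ofReal_pos.2 hS0).ne'
          · exact ENNReal.ofReal_ne_top
      _ ≤ ENNReal.ofReal S * m := by gcongr
  have h4 : ∫ u in a..b, f u ≤ S * m := by
    rw [intervalIntegral.integral_of_le hab, integral_eq_lintegral_of_nonneg_ae
      (Eventually.of_forall hf0) hfc.aestronglyMeasurable]
    refine ENNReal.toReal_le_of_le_ofReal (by positivity) ?_
    exact (setLIntegral_le_lintegral _ _).trans h3
  refine h4.trans_eq ?_
  rw [hSe]; ring

lemma proper_bound (hproper : ∀ t ∈ Iic (0:ℝ), IsProperMap fun u => γ u t)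
    (x₀ y₀ t : ℝ) (ht : t ≤ 0) (R : ℝ) :
    ∃ U : ℝ, ∀ u, U ≤ |u| → R ≤ (gX γ u t - x₀) ^ 2 + (gY γ u t - y₀) ^ 2 := by
  have h1 : IsCompact ((fun u => γ u t) ⁻¹' Metric.closedBall (toR2 x₀ y₀) (|R| + 1)) :=
    (hproper t ht).isCompact_preimage (isCompact_closedBall _ _)
  obtain ⟨U, hU⟩ := h1.isBounded.exists_norm_le
  refine ⟨U + 1, fun u hu => ?_⟩
  by_contra hcon
  push Not at hcon
  have hmem : u ∈ (fun u => γ u t) ⁻¹' Metric.closedBall (toR2 x₀ y₀) (|R| + 1) := by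
    rw [mem_preimage, mem_closedBall_iff_norm]
    have e := norm_sub_toR2_sq (γ u t) x₀ y₀
    have e2 : ‖γ u t - toR2 x₀ y₀‖ ^ 2 < R := by rw [e]; exact hcon
    have := le_abs_self R
    nlinarith [abs_nonneg R, norm_nonneg (γ u t - toR2 x₀ y₀)]
  have := hU u hmem
  rw [Real.norm_eq_abs] at this
  linarith

lemma cflow (h : IsCSF γ (Iic 0)) (m : ℕ)
    (hproper : ∀ t ∈ Iic (0:ℝ), IsProperMap fun u => γ u t)
    (hEnt : entropyE γ (Iic 0) = (m : ℝ≥0∞)) (x₀ y₀ : ℝ) :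
    CFlow (2 * m * Real.sqrt π) (fun u t => gX γ u t - x₀) (fun u t => gY γ u t - y₀)
      (gg γ) (gc γ) (gs γ) (gk γ) where
  dX u t ht := (h.sX.differentiableAt u t ht).sub_const x₀
  dY u t ht := (h.sY.differentiableAt u t ht).sub_const y₀
  dg u t ht := h.sg.differentiableAt u t ht
  dc u t ht := h.sc.differentiableAt u t ht
  ds u t ht := h.ss.differentiableAt u t ht
  ck u t ht := (h.sk.differentiableAt u t ht).continuousAt
  Xu u t ht := (h.p_eq u t ht.le ▸ h.sX.hasDerivAt u t ht.le :
    HasDerivAt (fun v => gX γ v t) (gg γ u t * gc γ u t) u).sub_const x₀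
  Yu u t ht := (h.q_eq u t ht.le ▸ h.sY.hasDerivAt u t ht.le :
    HasDerivAt (fun v => gY γ v t) (gg γ u t * gs γ u t) u).sub_const y₀
  cu u t ht := h.cu u t ht.le
  su u t ht := h.su u t ht.le
  Xt u t ht := (h.Xt u t ht).sub_const x₀
  Yt u t ht := (h.Yt u t ht).sub_const y₀
  gt u t ht := h.g_t u t ht
  gpos u t ht := h.gpos u t ht.le
  cs u t ht := h.cs u t ht.le
  proper t ht R := proper_bound hproper x₀ y₀ t ht.le R
  ent t ht l hl a b hab := h.ent_bound m hEnt x₀ y₀ t ht.le l hl a b hab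

end IsCSF

/-- A nonnegative continuous function with bounded integrals on compact intervals. -/
lemma lintegral_le_of_intervals {f : ℝ → ℝ} (hf : Continuous f) (hf0 : ∀ u, 0 ≤ f u) {B : ℝ}
    (h : ∀ a b, a < b → ∫ u in a..b, f u ≤ B) :
    ∫⁻ u, ENNReal.ofReal (f u) ≤ ENNReal.ofReal B := by
  have hcov : AECover (volume : Measure ℝ) atTop fun n : ℕ => Ioc (-((n : ℝ) + 1)) ((n : ℝ) + 1) :=
    aecover_Ioc
      (tendsto_neg_atTop_atBot.comp (tendsto_atTop_add_const_right _ 1 tendsto_natCast_atTop_atTop))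
      (tendsto_atTop_add_const_right _ 1 tendsto_natCast_atTop_atTop)
  have hlim := hcov.lintegral_tendsto_of_countably_generated
    (f := fun u => ENNReal.ofReal (f u)) (by fun_prop)
  refine le_of_tendsto hlim (Eventually.of_forall fun n => ?_)
  have hab : -((n : ℝ) + 1) < (n : ℝ) + 1 := by
    have : (0 : ℝ) ≤ n := Nat.cast_nonneg n
    linarith
  have h1 := h _ _ hab
  rw [intervalIntegral.integral_of_le hab.le] at h1
  rw [← ofReal_integral_eq_lintegral_ofReal]
  · exact ENNReal.ofReal_le_ofReal h1
  · exact (hf.intervalIntegrable _ _).1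
  · exact Eventually.of_forall hf0

/-- An ancient complete non-compact embedded smooth curve shortening flow
with entropy equal to a positive integer `m` has total curvature at most `(2m-1)π` at
every time. -/
theorem totalCurvature_le_of_entropy_eq
    (γ : ℝ → ℝ → R2) (m : ℕ) (hm : 0 < m)
    (hcsf : IsCSF γ (Iic 0))
    (hemb : ∀ t ∈ Iic (0:ℝ), Function.Injective fun u => γ u t)
    (hproper : ∀ t ∈ Iic (0:ℝ), IsProperMap fun u => γ u t)
    (hEnt : entropyE γ (Iic 0) = (m : ℝ≥0∞)) :
    ∀ t ∈ Iic (0:ℝ), totalCurvE γ t ≤ ENNReal.ofReal ((2 * (m:ℝ) - 1) * π) := by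
  intro t ht
  have hq : Continuous fun u => gg γ u t * gk γ u t :=
    (hcsf.sg.cont_u t ht).mul (hcsf.sk.cont_u t ht)
  have h1 : totalCurvE γ t = ∫⁻ u : ℝ, ENNReal.ofReal |gg γ u t * gk γ u t| := by
    refine lintegral_congr fun u => ?_
    rw [hcsf.speed u t ht, hcsf.curv_eq u t ht, abs_mul, abs_of_pos (hcsf.gpos u t ht), mul_comm]
  rw [h1]
  refine lintegral_le_of_intervals hq.abs (fun u => abs_nonneg _) fun a b hab => ?_
  exact curv_bound m hm (fun x₀ y₀ => hcsf.cflow m hproper hEnt x₀ y₀)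
    hcsf.sc.tendsto_zero hcsf.ss.tendsto_zero t ht hq
    (fun u => hcsf.cs u t ht) (fun u => hcsf.cu u t ht) (fun u => hcsf.su u t ht) a b hab
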